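/- There exist constants C > 0 and K ≥ 0 such that for all real N ≥ 16 one has A(N) ≤ C · N · (log log N)^K / (log N)^η, where η = 1 − (1 + log log 2)/log 2 is the Erdős–Ford–Tenenbaum constant. -/

import Mathlib

open Real

/-- `countA N` is the number of integers `n` with `1 ≤ n ≤ N` such that `n = a * b`
for some positive integers `a, b` with `a² + b² = 2p` for some prime `p`. -/
noncomputable def countA (N : ℝ) : ℕ :=
  {n : ℕ | 1 ≤ n ∧ (n : ℝ) ≤ N ∧
    ∃ a b : ℕ, 0 < a ∧ 0 < b ∧ n = a * b ∧
      ∃ p : ℕ, p.Prime ∧ a ^ 2 + b ^ 2 = 2 * p}.ncard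

/-- A truncated sum of a nonnegative function is at most its sum over smooth numbers. -/
lemma sum_Ioc_le_of_hasSum_smoothNumbers {f : ℕ → ℝ} (hf : ∀ n, 0 ≤ f n) {n : ℕ} {P : ℝ}
    (h : HasSum (fun m : (n + 1).smoothNumbers ↦ f m) P) :
    ∑ m ∈ Finset.Ioc 0 n, f m ≤ P := by
  have h := (hasSum_subtype_iff_indicator (f := f) (s := (n + 1).smoothNumbers)).1 h
  refine le_trans (Finset.sum_le_sum fun m hm ↦ ?_)
    (sum_le_hasSum (Finset.Ioc 0 n) (fun i _ ↦ Set.indicator_nonneg (fun _ _ ↦ hf _) i) h)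
  rw [Finset.mem_Ioc] at hm
  rw [Set.indicator_of_mem]
  exact Nat.mem_smoothNumbers_of_lt hm.1 (by omega)

lemma sum_primesBelow_inv_sq_le (n : ℕ) : ∑ p ∈ n.primesBelow, 1 / (p : ℝ) ^ 2 ≤ 2 := by
  rcases Nat.eq_zero_or_pos n with rfl | hn
  · simp
  have h : n.primesBelow ⊆ Finset.Ioc 1 n := fun p hp ↦ by
    rw [Nat.mem_primesBelow] at hp
    exact Finset.mem_Ioc.2 ⟨hp.2.one_lt, hp.1.le⟩
  calc ∑ p ∈ n.primesBelow, 1 / (p : ℝ) ^ 2 ≤ ∑ p ∈ Finset.Ioc 1 n, 1 / (p : ℝ) ^ 2 :=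
        Finset.sum_le_sum_of_subset_of_nonneg h fun _ _ _ ↦ by positivity
    _ ≤ 1 - (n : ℝ)⁻¹ := by
        simpa using sum_Ioc_inv_sq_le_sub (α := ℝ) one_ne_zero hn
    _ ≤ 2 := by
        have : (0 : ℝ) ≤ (n : ℝ)⁻¹ := by positivity
        linarith

lemma one_sub_inv_le_exp {x c : ℝ} (hx : x ≤ c) (hc : c < 1) :
    (1 - x)⁻¹ ≤ exp (x + x ^ 2 / (1 - c)) := by
  have h1 : 0 < 1 - x := by linarith
  have h2 : (1 - x)⁻¹ = x + x ^ 2 / (1 - x) + 1 := by field_simp; ring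
  rw [h2]
  refine le_trans ?_ (add_one_le_exp _)
  gcongr

/-- The completely multiplicative function `n ↦ t ^ Ω(n) / n`. -/
noncomputable def omegaWeight (t : ℝ) : ℕ →* ℝ where
  toFun n := t ^ ArithmeticFunction.cardFactors n / n
  map_one' := by simp
  map_mul' m n := by
    rcases eq_or_ne m 0 with rfl | hm
    · simp
    rcases eq_or_ne n 0 with rfl | hn
    · simp
    rw [ArithmeticFunction.cardFactors_mul hm hn, pow_add]
    push_cast
    field_simp

lemma omegaWeight_prime (t : ℝ) {p : ℕ} (hp : p.Prime) : omegaWeight t p = t / p := by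
  simp [omegaWeight, ArithmeticFunction.cardFactors_apply_prime hp]

/-- Upper bound for a weighted harmonic sum by an Euler product. -/
lemma sum_omegaWeight_le_exp {t : ℝ} (ht : 0 < t) (ht2 : t < 2) : ∃ C : ℝ, 0 < C ∧ ∀ n : ℕ,
    ∑ m ∈ Finset.Ioc 0 n, t ^ ArithmeticFunction.cardFactors m / (m : ℝ) ≤
      C * exp (t * ∑ p ∈ (n + 1).primesBelow, 1 / (p : ℝ)) := by
  refine ⟨exp (2 * (t ^ 2 / (1 - t / 2))), exp_pos _, fun n ↦ ?_⟩
  have hpt : ∀ {p : ℕ}, p.Prime → t / p ≤ t / 2 := fun hp ↦ by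
    have : (2 : ℝ) ≤ _ := Nat.cast_le.2 hp.two_le
    gcongr
  have h := (EulerProduct.summable_and_hasSum_smoothNumbers_prod_primesBelow_geometric
    (f := omegaWeight t) (fun {p} hp ↦ by
      rw [omegaWeight_prime t hp, norm_of_nonneg (by positivity)]
      linarith [hpt hp]) (n + 1)).2
  refine (sum_Ioc_le_of_hasSum_smoothNumbers (f := omegaWeight t) (fun m ↦ ?_) h).trans ?_
  · change 0 ≤ t ^ _ / (m : ℝ)
    positivity
  · calc ∏ p ∈ (n + 1).primesBelow, (1 - omegaWeight t p)⁻¹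
      ≤ ∏ p ∈ (n + 1).primesBelow,
          exp (t * (1 / (p : ℝ)) + t ^ 2 / (1 - t / 2) * (1 / (p : ℝ) ^ 2)) := by
          refine Finset.prod_le_prod (fun p hp ↦ ?_) fun p hp ↦ ?_ <;>
            have hp' := Nat.prime_of_mem_primesBelow hp <;> rw [omegaWeight_prime t hp']
          · have := hpt hp'
            rw [inv_nonneg]; linarith
          · refine (one_sub_inv_le_exp (hpt hp') (by linarith)).trans_eq ?_
            congr 1
            ring
      _ = exp (t ^ 2 / (1 - t / 2) * ∑ p ∈ (n + 1).primesBelow, 1 / (p : ℝ) ^ 2) *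
          exp (t * ∑ p ∈ (n + 1).primesBelow, 1 / (p : ℝ)) := by
          rw [← exp_sum, Finset.sum_add_distrib, ← Finset.mul_sum, ← Finset.mul_sum, exp_add,
            mul_comm]
      _ ≤ _ := by
          gcongr ?_ * _
          rw [exp_le_exp, mul_comm]
          have : 0 < 1 - t / 2 := by linarith
          gcongr
          exact sum_primesBelow_inv_sq_le _

lemma log_le_sum_Ioc_inv (n : ℕ) : log (n + 1) ≤ ∑ m ∈ Finset.Ioc 0 n, 1 / (m : ℝ) := by
  have := log_add_one_le_harmonic n
  rw [harmonic_eq_sum_Icc] at this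
  push_cast at this
  simpa [← Finset.Icc_add_one_left_eq_Ioc] using this

/-- Lower bound in the second theorem of Mertens. -/
lemma log_le_exp_sum_primes_inv : ∃ C : ℝ, 0 < C ∧ ∀ n : ℕ,
    log (n + 1) ≤ C * exp (∑ p ∈ (n + 1).primesBelow, 1 / (p : ℝ)) := by
  obtain ⟨C, hC, h⟩ := sum_omegaWeight_le_exp one_pos one_lt_two
  refine ⟨C, hC, fun n ↦ (log_le_sum_Ioc_inv n).trans ?_⟩
  simpa using h n

/-- Upper bound in the first theorem of Mertens. -/
lemma sum_log_div_le (n : ℕ) : ∑ p ∈ (n + 1).primesBelow, log p / (p : ℝ) ≤ log n + log 4 := by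
  rcases Nat.eq_zero_or_pos n with rfl | hn
  · simp [Nat.primesBelow_succ, Nat.not_prime_zero, log_nonneg]
  have h1 : ∑ p ∈ (n + 1).primesBelow, (n / p : ℕ) * log p ≤ n * log n := by
    calc ∑ p ∈ (n + 1).primesBelow, (n / p : ℕ) * log p
        = ∑ p ∈ (n + 1).primesBelow, ∑ m ∈ Finset.Ioc 0 n, if p ∣ m then log p else 0 := by
          refine Finset.sum_congr rfl fun p _ ↦ ?_
          rw [← Finset.sum_filter, Finset.sum_const, Nat.Ioc_filter_dvd_card_eq_div, nsmul_eq_mul]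
      _ = ∑ m ∈ Finset.Ioc 0 n, ∑ p ∈ (n + 1).primesBelow, if p ∣ m then log p else 0 :=
          Finset.sum_comm
      _ ≤ ∑ m ∈ Finset.Ioc 0 n, log n := by
          refine Finset.sum_le_sum fun m hm ↦ ?_
          rw [Finset.mem_Ioc] at hm
          have hsub : (n + 1).primesBelow.filter (· ∣ m) ⊆ m.primeFactors := by
            intro p hp
            rw [Finset.mem_filter, Nat.mem_primesBelow] at hp
            exact Nat.mem_primeFactors.2 ⟨hp.1.2, hp.2, by omega⟩
          rw [← Finset.sum_filter]
          calc _ ≤ ∑ p ∈ m.primeFactors, log (p : ℝ) :=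
                Finset.sum_le_sum_of_subset_of_nonneg hsub fun p _ _ ↦ log_natCast_nonneg p
            _ = log ((∏ p ∈ m.primeFactors, p : ℕ) : ℝ) := by
                rw [Nat.cast_prod, log_prod]
                intro p hp
                exact_mod_cast (Nat.prime_of_mem_primeFactors hp).ne_zero
            _ ≤ log n := by
                have h0 : 0 < ∏ p ∈ m.primeFactors, p :=
                  Finset.prod_pos fun p hp ↦ (Nat.prime_of_mem_primeFactors hp).pos
                have := Nat.le_of_dvd hm.1 (Nat.prod_primeFactors_dvd m)
                gcongr
                exact this.trans hm.2
      _ = n * log n := by simp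
  have h2 : ∑ p ∈ (n + 1).primesBelow, log (p : ℝ) ≤ log 4 * n := by
    have h := Chebyshev.theta_le_log4_mul_x (x := n) (by positivity)
    rw [Chebyshev.theta_eq_sum_primesLE_log] at h
    exact h
  have hn' : (0 : ℝ) < n := by exact_mod_cast hn
  rw [← mul_le_mul_iff_right₀ hn', Finset.mul_sum]
  calc ∑ p ∈ (n + 1).primesBelow, n * (log p / (p : ℝ))
      ≤ ∑ p ∈ (n + 1).primesBelow, ((n / p : ℕ) * log p + log p) := by
        refine Finset.sum_le_sum fun p hp ↦ ?_
        have hp' : 0 < p := (Nat.prime_of_mem_primesBelow hp).pos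
        have : (n : ℝ) / p ≤ (n / p : ℕ) + 1 := by
          rw [div_le_iff₀ (by exact_mod_cast hp')]
          have := Nat.lt_div_mul_add (a := n) hp'
          have : n ≤ (n / p + 1) * p := by linarith
          exact_mod_cast this
        calc n * (log p / (p : ℝ)) = (n : ℝ) / p * log p := by ring
          _ ≤ ((n / p : ℕ) + 1) * log p := by
            gcongr
          _ = _ := by ring
    _ ≤ _ := by
        rw [Finset.sum_add_distrib]
        linarith

/-- The completely multiplicative function `n ↦ n ^ (-s)`. -/
noncomputable def negRpow (s : ℝ) : ℕ →* ℝ where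
  toFun n := (n : ℝ) ^ (-s)
  map_one' := by simp
  map_mul' m n := by
    push_cast
    rw [mul_rpow (by positivity) (by positivity)]

lemma exp_sum_primes_rpow_le {s : ℝ} (hs : 1 < s) (n : ℕ) :
    exp (∑ p ∈ n.primesBelow, (p : ℝ) ^ (-s)) ≤ ∑' m : ℕ, 1 / (m : ℝ) ^ s := by
  have hf : (fun m : ℕ ↦ 1 / (m : ℝ) ^ s) = negRpow s := by
    ext m
    change _ = (m : ℝ) ^ (-s)
    rw [rpow_neg (by positivity), one_div]
  have hsum : Summable (negRpow s) := hf ▸ summable_one_div_nat_rpow.2 hs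
  have hnn : ∀ m : ℕ, 0 ≤ negRpow s m := fun m ↦ by
    change 0 ≤ (m : ℝ) ^ (-s)
    positivity
  rw [hf]
  have h := EulerProduct.prod_primesBelow_geometric_eq_tsum_smoothNumbers hsum n
  rw [exp_sum]
  calc ∏ p ∈ n.primesBelow, exp ((p : ℝ) ^ (-s))
      ≤ ∏ p ∈ n.primesBelow, (1 - negRpow s p)⁻¹ := by
        refine Finset.prod_le_prod (fun _ _ ↦ (exp_pos _).le) fun p hp ↦ ?_
        have hp1 : negRpow s p < 1 := by
          have := hsum.norm_lt_one (Nat.prime_of_mem_primesBelow hp).one_lt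
          rwa [norm_of_nonneg (hnn p)] at this
        rw [← inv_inv (exp _), ← exp_neg]
        have h2 := one_sub_le_exp_neg (negRpow s p)
        exact inv_anti₀ (by linarith) h2
    _ = ∑' m : n.smoothNumbers, negRpow s m := h
    _ ≤ ∑' m : ℕ, negRpow s m := hsum.tsum_subtype_le _ _ hnn

/-- Upper bound in the second theorem of Mertens. -/
lemma exp_sum_primes_inv_le : ∃ C : ℝ, 0 < C ∧ ∀ n : ℕ, 2 ≤ n →
    exp (∑ p ∈ (n + 1).primesBelow, 1 / (p : ℝ)) ≤ C * log n := by
  have hlim : Filter.Tendsto (fun n : ℕ ↦ 1 + 1 / log n) Filter.atTop (nhdsWithin 1 (Set.Ioi 1)) := by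
    have h1 : Filter.Tendsto (fun n : ℕ ↦ log n) Filter.atTop Filter.atTop :=
      tendsto_log_atTop.comp tendsto_natCast_atTop_atTop
    rw [tendsto_nhdsWithin_iff]
    refine ⟨?_, ?_⟩
    · simpa using (h1.inv_tendsto_atTop).const_add 1
    · filter_upwards [h1.eventually_gt_atTop 0] with n hn
      simpa using hn
  have hev := (tendsto_sub_mul_tsum_nat_rpow.comp hlim).eventually_le_const one_lt_two
  obtain ⟨n₀, hn₀⟩ := Filter.eventually_atTop.1 hev
  set S : ℝ := exp (∑ p ∈ (n₀ + 1).primesBelow, 1 / (p : ℝ)) with hS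
  have hlog2 : 0 < log 2 := log_pos one_lt_two
  refine ⟨S / log 2 + 2 * exp (1 + log 4 / log 2), by positivity, fun n hn ↦ ?_⟩
  have hn' : (2 : ℝ) ≤ n := by exact_mod_cast hn
  have hl2 : log 2 ≤ log n := log_le_log two_pos hn'
  have hl : 0 < log n := hlog2.trans_le hl2
  rcases le_total n n₀ with h | h
  · calc exp (∑ p ∈ (n + 1).primesBelow, 1 / (p : ℝ)) ≤ S := by
          rw [hS, exp_le_exp]
          refine Finset.sum_le_sum_of_subset_of_nonneg (fun p hp ↦ ?_) fun _ _ _ ↦ by positivity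
          rw [Nat.mem_primesBelow] at hp ⊢
          exact ⟨by omega, hp.2⟩
      _ = S / log 2 * log 2 := by field_simp
      _ ≤ S / log 2 * log n := by gcongr
      _ ≤ _ := by
          gcongr
          have := exp_pos (1 + log 4 / log 2)
          linarith
  · have h1 := hn₀ n h
    set s : ℝ := 1 + 1 / log n with hs
    have hs1 : s - 1 = (log n)⁻¹ := by rw [hs]; ring
    have hs' : 1 < s := by rw [hs]; linarith [one_div_pos.2 hl]
    simp only [Function.comp_apply, ← hs] at h1
    rw [hs1, inv_mul_le_iff₀ hl] at h1
    have h2 := (exp_sum_primes_rpow_le hs' (n + 1)).trans h1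
    have h3 : ∑ p ∈ (n + 1).primesBelow, 1 / (p : ℝ) ≤
        ∑ p ∈ (n + 1).primesBelow, (p : ℝ) ^ (-s) + (1 + log 4 / log 2) := by
      calc ∑ p ∈ (n + 1).primesBelow, 1 / (p : ℝ)
          ≤ ∑ p ∈ (n + 1).primesBelow, ((p : ℝ) ^ (-s) + log p / p / log n) := by
            refine Finset.sum_le_sum fun p hp ↦ ?_
            have hp0 : (0 : ℝ) < p := by exact_mod_cast (Nat.prime_of_mem_primesBelow hp).pos
            have h4 : (p : ℝ) ^ (-s) = 1 / p * exp (-(log p / log n)) := by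
              rw [show -s = -1 + -(1 / log n) by rw [hs]; ring, rpow_add hp0, rpow_neg_one,
                rpow_def_of_pos hp0, mul_neg, mul_one_div, one_div]
            have h5 := one_sub_le_exp_neg (log p / log n)
            calc 1 / (p : ℝ) = 1 / p * (1 - log p / log n) + log p / p / log n := by ring
              _ ≤ _ := by rw [h4]; gcongr
        _ = ∑ p ∈ (n + 1).primesBelow, (p : ℝ) ^ (-s) +
            (∑ p ∈ (n + 1).primesBelow, log p / p) / log n := by
            rw [Finset.sum_add_distrib, Finset.sum_div]
        _ ≤ ∑ p ∈ (n + 1).primesBelow, (p : ℝ) ^ (-s) + (log n + log 4) / log n := by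
            gcongr
            exact sum_log_div_le n
        _ = ∑ p ∈ (n + 1).primesBelow, (p : ℝ) ^ (-s) + (1 + log 4 / log n) := by
            rw [add_div, div_self hl.ne']
        _ ≤ _ := by
            gcongr
    calc exp (∑ p ∈ (n + 1).primesBelow, 1 / (p : ℝ))
        ≤ exp (∑ p ∈ (n + 1).primesBelow, (p : ℝ) ^ (-s) + (1 + log 4 / log 2)) :=
          exp_le_exp.2 h3
      _ ≤ log n * 2 * exp (1 + log 4 / log 2) := by
          rw [exp_add]
          gcongr
      _ = 0 + 2 * exp (1 + log 4 / log 2) * log n := by ring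
      _ ≤ _ := by
          rw [add_mul]
          gcongr
          positivity

/-- Weighted harmonic sums of `t ^ Ω(m)` grow at most like `(log n) ^ t`. -/
lemma sum_omegaWeight_le {t : ℝ} (ht : 0 < t) (ht2 : t < 2) : ∃ C : ℝ, 0 < C ∧ ∀ n : ℕ, 2 ≤ n →
    ∑ m ∈ Finset.Ioc 0 n, t ^ ArithmeticFunction.cardFactors m / (m : ℝ) ≤ C * log n ^ t := by
  obtain ⟨C₁, hC₁, h₁⟩ := sum_omegaWeight_le_exp ht ht2
  obtain ⟨C₂, hC₂, h₂⟩ := exp_sum_primes_inv_le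
  refine ⟨C₁ * C₂ ^ t, by positivity, fun n hn ↦ (h₁ n).trans ?_⟩
  have hl : 0 ≤ log (n : ℝ) := log_natCast_nonneg n
  rw [mul_assoc, ← mul_rpow hC₂.le hl, mul_comm t, exp_mul]
  gcongr
  exact h₂ n hn

/-- The arithmetic function `n ↦ 1 / n`. -/
noncomputable def invArith : ArithmeticFunction ℝ where
  toFun n := 1 / (n : ℝ)
  map_zero' := by simp

/-- The arithmetic function `n ↦ χ₄(n) / n`. -/
noncomputable def chiArith : ArithmeticFunction ℝ where
  toFun n := (ZMod.χ₄ n : ℝ) / n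
  map_zero' := by simp

lemma invArith_apply (n : ℕ) : invArith n = 1 / (n : ℝ) := rfl

lemma chiArith_apply (n : ℕ) : chiArith n = (ZMod.χ₄ n : ℝ) / n := rfl

/-- The convolution of `1 / n` and `χ₄(n) / n`. -/
noncomputable def chiConv : ArithmeticFunction ℝ := invArith * chiArith

lemma chiConv_isMultiplicative : chiConv.IsMultiplicative := by
  refine ArithmeticFunction.IsMultiplicative.mul ⟨?_, fun {m n} _ ↦ ?_⟩
    ⟨?_, fun {m n} _ ↦ ?_⟩
  · simp [invArith_apply]
  · simp [invArith_apply, mul_comm]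
  · simp [chiArith_apply]
  · simp only [chiArith_apply, Nat.cast_mul, map_mul, Int.cast_mul]
    rw [mul_div_mul_comm]

lemma chiConv_prime_pow {p : ℕ} (hp : p.Prime) (k : ℕ) :
    chiConv (p ^ k) = (∑ j ∈ Finset.range (k + 1), (ZMod.χ₄ p : ℝ) ^ j) / (p : ℝ) ^ k := by
  have hp0 : (p : ℝ) ≠ 0 := by exact_mod_cast hp.ne_zero
  rw [chiConv, ArithmeticFunction.mul_apply, Nat.sum_divisorsAntidiagonal'
    (f := fun a b ↦ invArith a * chiArith b), Nat.sum_divisors_prime_pow hp,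
    Finset.sum_div]
  refine Finset.sum_congr rfl fun j hj ↦ ?_
  have hj : j ≤ k := by simpa [Nat.lt_succ_iff] using hj
  have hk : (p : ℝ) ^ k = p ^ (k - j) * p ^ j := by rw [← pow_add, Nat.sub_add_cancel hj]
  rw [Nat.pow_div hj hp.pos, hk, invArith_apply, chiArith_apply]
  push_cast
  rw [map_pow]
  push_cast
  field_simp

lemma chi_values (p : ℕ) : ZMod.χ₄ p = 0 ∨ ZMod.χ₄ p = 1 ∨ ZMod.χ₄ p = -1 := by
  generalize (p : ZMod 4) = a
  revert a
  decide

lemma chiConv_nonneg (n : ℕ) : 0 ≤ chiConv n := by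
  rcases eq_or_ne n 0 with rfl | hn
  · simp
  rw [chiConv_isMultiplicative.multiplicative_factorization _ hn]
  refine Finset.prod_nonneg fun p hp ↦ ?_
  beta_reduce
  rw [chiConv_prime_pow (Nat.prime_of_mem_primeFactors hp)]
  refine div_nonneg ?_ (by positivity)
  rcases chi_values p with h | h | h
  · rw [h]
    exact Finset.sum_nonneg fun _ _ ↦ by simp
  · rw [h]
    exact Finset.sum_nonneg fun _ _ ↦ by simp
  · rw [h]
    push_cast
    rw [neg_one_geom_sum]
    split_ifs <;> norm_num

lemma sum_chi_div_ge {n : ℕ} (hn : 1 ≤ n) :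
    2 / 3 ≤ ∑ m ∈ Finset.Ioc 0 n, (ZMod.χ₄ m : ℝ) / m := by
  set S : ℕ → ℝ := fun n ↦ ∑ m ∈ Finset.Ioc 0 n, (ZMod.χ₄ m : ℝ) / m with hS
  have hs : ∀ n, S (n + 1) = S n + (ZMod.χ₄ (n + 1 : ℕ) : ℝ) / (n + 1 : ℕ) := fun n ↦
    Finset.sum_Ioc_succ_top (Nat.zero_le n) _
  have c1 : ∀ k, S (4 * k + 1) = S (4 * k) + 1 / (4 * k + 1) := fun k ↦ by
    rw [hs, ZMod.χ₄_nat_one_mod_four (by omega)]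
    push_cast
    rfl
  have c2 : ∀ k, S (4 * k + 2) = S (4 * k + 1) := fun k ↦ by
    rw [hs, ZMod.χ₄_nat_eq_if_mod_four, if_pos (by omega)]
    simp
  have c3 : ∀ k, S (4 * k + 3) = S (4 * k + 2) - 1 / (4 * k + 3) := fun k ↦ by
    rw [hs, ZMod.χ₄_nat_three_mod_four (by omega)]
    push_cast
    ring
  have c4 : ∀ k, S (4 * k + 4) = S (4 * k + 3) := fun k ↦ by
    rw [hs, ZMod.χ₄_nat_eq_if_mod_four, if_pos (by omega)]
    simp
  have h0 : S 0 = 0 := by simp [hS]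
  have hle : ∀ k : ℕ, (1 : ℝ) / (4 * k + 3) ≤ 1 / (4 * k + 1) := fun k ↦ by
    gcongr
    norm_num
  have h3 : ∀ k, 2 / 3 ≤ S (4 * k + 3) := by
    intro k
    induction k with
    | zero => rw [c3, c2, c1, mul_zero, h0]; norm_num
    | succ k ih =>
      have := hle (k + 1)
      rw [c3, c2, c1, show 4 * (k + 1) = 4 * k + 4 by ring, c4]
      linarith
  have h1 : ∀ k, 2 / 3 ≤ S (4 * k + 1) := fun k ↦ by
    have := h3 k
    have h5 : (0 : ℝ) ≤ 1 / (4 * k + 3) := by positivity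
    rw [c3, c2] at this
    linarith
  have hmod : n % 4 < 4 := Nat.mod_lt _ (by norm_num)
  have hdiv := Nat.div_add_mod n 4
  change 2 / 3 ≤ S n
  interval_cases h : n % 4
  · obtain ⟨k, hk⟩ : ∃ k, n = 4 * k + 4 := ⟨n / 4 - 1, by omega⟩
    rw [hk, c4]
    exact h3 k
  · rw [← hdiv]
    exact h1 _
  · rw [← hdiv, c2]
    exact h1 _
  · rw [← hdiv]
    exact h3 _

lemma log_le_sum_chiConv (n : ℕ) : 2 / 3 * log (n + 1) ≤ ∑ m ∈ Finset.Ioc 0 n, chiConv m := by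
  rw [chiConv, ArithmeticFunction.sum_Ioc_mul_eq_sum_sum]
  calc 2 / 3 * log (n + 1) ≤ 2 / 3 * ∑ m ∈ Finset.Ioc 0 n, 1 / (m : ℝ) := by
        gcongr
        exact log_le_sum_Ioc_inv n
    _ = ∑ m ∈ Finset.Ioc 0 n, 1 / (m : ℝ) * (2 / 3) := by
        rw [Finset.mul_sum]
        exact Finset.sum_congr rfl fun _ _ ↦ mul_comm _ _
    _ ≤ _ := by
        refine Finset.sum_le_sum fun m hm ↦ ?_
        rw [Finset.mem_Ioc] at hm
        refine mul_le_mul_of_nonneg_left ?_ (by positivity)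
        exact sum_chi_div_ge (Nat.div_pos hm.2 hm.1)

lemma chiConv_prime_pow_le {p : ℕ} (hp : p.Prime) (k : ℕ) :
    chiConv (p ^ k) ≤ (k + 1) * (1 / (p : ℝ)) ^ k +
      if k = 1 then ((ZMod.χ₄ p : ℝ) - 1) * (1 / (p : ℝ)) else 0 := by
  have hp0 : (p : ℝ) ≠ 0 := by exact_mod_cast hp.ne_zero
  rw [chiConv_prime_pow hp]
  split_ifs with h
  · subst h
    rw [Finset.sum_range_succ, Finset.sum_range_one]
    push_cast
    apply le_of_eq
    field_simp
    ring
  · rw [add_zero, div_eq_mul_one_div, ← one_div_pow]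
    gcongr
    calc ∑ j ∈ Finset.range (k + 1), (ZMod.χ₄ p : ℝ) ^ j
        ≤ ∑ j ∈ Finset.range (k + 1), 1 := by
          refine Finset.sum_le_sum fun j _ ↦ ?_
          rcases chi_values p with h | h | h <;> rw [h]
          · simpa using pow_le_one₀ (n := j) (le_refl (0 : ℝ)) zero_le_one
          · simp
          · push_cast
            rcases neg_one_pow_eq_or ℝ j with h | h <;> rw [h]
            norm_num
      _ = k + 1 := by simp

lemma hasSum_chiConv_bound {p : ℕ} (hp : p.Prime) :
    HasSum (fun k : ℕ ↦ ((k : ℝ) + 1) * (1 / (p : ℝ)) ^ k +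
      if k = 1 then ((ZMod.χ₄ p : ℝ) - 1) * (1 / (p : ℝ)) else 0)
      (1 / (1 - 1 / (p : ℝ)) ^ 2 + ((ZMod.χ₄ p : ℝ) - 1) * (1 / (p : ℝ))) := by
  have hp1 : (1 : ℝ) < p := by exact_mod_cast hp.one_lt
  refine HasSum.add ?_ (hasSum_ite_eq 1 _)
  have h := hasSum_choose_mul_geometric_of_norm_lt_one (𝕜 := ℝ) 1 (r := 1 / (p : ℝ)) (by
    rw [norm_of_nonneg (by positivity), div_lt_one (by positivity)]
    exact hp1)
  simpa using h

lemma log_le_exp_sum_chi : ∃ C : ℝ, 0 < C ∧ ∀ n : ℕ,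
    log (n + 1) ≤ C * exp (∑ p ∈ (n + 1).primesBelow, (1 + (ZMod.χ₄ p : ℝ)) / (p : ℝ)) := by
  refine ⟨3 / 2 * exp (12 * 2), by positivity, fun n ↦ ?_⟩
  have hsum : ∀ {p : ℕ}, p.Prime → Summable (fun k : ℕ ↦ ‖chiConv (p ^ k)‖) := fun {p} hp ↦ by
    refine Summable.of_nonneg_of_le (fun _ ↦ norm_nonneg _) (fun k ↦ ?_)
      (hasSum_chiConv_bound hp).summable
    rw [norm_of_nonneg (chiConv_nonneg _)]
    exact chiConv_prime_pow_le hp k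
  have h := (EulerProduct.summable_and_hasSum_smoothNumbers_prod_primesBelow_tsum
    chiConv_isMultiplicative.1 chiConv_isMultiplicative.2 hsum (n + 1)).2
  have h1 := (log_le_sum_chiConv n).trans (sum_Ioc_le_of_hasSum_smoothNumbers chiConv_nonneg h)
  have h2 : ∏ p ∈ (n + 1).primesBelow, ∑' k : ℕ, chiConv (p ^ k) ≤
      exp (12 * 2) * exp (∑ p ∈ (n + 1).primesBelow, (1 + (ZMod.χ₄ p : ℝ)) / (p : ℝ)) := by
    calc ∏ p ∈ (n + 1).primesBelow, ∑' k : ℕ, chiConv (p ^ k)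
        ≤ ∏ p ∈ (n + 1).primesBelow,
            exp (12 * (1 / (p : ℝ) ^ 2) + (1 + (ZMod.χ₄ p : ℝ)) / (p : ℝ)) := by
          refine Finset.prod_le_prod (fun p _ ↦ tsum_nonneg fun _ ↦ chiConv_nonneg _)
            fun p hp ↦ ?_
          have hp' := Nat.prime_of_mem_primesBelow hp
          have h3 := (hsum hp').of_norm.tsum_le_tsum (chiConv_prime_pow_le hp')
            (hasSum_chiConv_bound hp').summable
          rw [(hasSum_chiConv_bound hp').tsum_eq] at h3
          refine h3.trans (le_trans ?_ (add_one_le_exp _))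
          have hp2 : (2 : ℝ) ≤ p := by exact_mod_cast hp'.two_le
          set x : ℝ := 1 / p with hx
          have hx0 : 0 < x := by positivity
          have hx2 : x ≤ 1 / 2 := one_div_le_one_div_of_le two_pos hp2
          have h4 : 1 / (1 - x) ^ 2 ≤ 1 + 2 * x + 12 * x ^ 2 := by
            rw [div_le_iff₀ (by nlinarith)]
            nlinarith [mul_nonneg (sq_nonneg x) (by nlinarith : (0 : ℝ) ≤ 9 - 22 * x + 12 * x ^ 2)]
          have h5 : 1 / (p : ℝ) ^ 2 = x ^ 2 := by rw [hx, one_div_pow]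
          rw [h5, div_eq_mul_one_div (1 + _), ← hx]
          linarith
      _ = exp (12 * ∑ p ∈ (n + 1).primesBelow, 1 / (p : ℝ) ^ 2) *
          exp (∑ p ∈ (n + 1).primesBelow, (1 + (ZMod.χ₄ p : ℝ)) / (p : ℝ)) := by
          rw [← exp_sum, Finset.sum_add_distrib, ← Finset.mul_sum, exp_add]
      _ ≤ _ := by
          gcongr
          exact sum_primesBelow_inv_sq_le _
  linarith

lemma abs_card_modEq_sub_le {d : ℕ} (hd : 0 < d) (c M : ℕ) :
    |(((Finset.Ioc 0 M).filter (fun x ↦ x ≡ c [MOD d])).card : ℝ) - M / d| ≤ 1 := by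
  have h := Nat.Ioc_filter_modEq_card 0 M hd c
  have h' : (((Finset.Ioc 0 M).filter (fun x ↦ x ≡ c [MOD d])).card : ℤ) =
      ⌊((M : ℚ) - c) / d⌋ - ⌊((0 : ℕ) - (c : ℚ)) / d⌋ := by
    rw [h, max_eq_left]
    rw [sub_nonneg]
    gcongr
    exact_mod_cast Nat.zero_le M
  have hq : |(((Finset.Ioc 0 M).filter (fun x ↦ x ≡ c [MOD d])).card : ℚ) - M / d| ≤ 1 := by
    have h'' : (((Finset.Ioc 0 M).filter (fun x ↦ x ≡ c [MOD d])).card : ℚ) =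
      ⌊((M : ℚ) - c) / d⌋ - ⌊((0 : ℕ) - (c : ℚ)) / d⌋ := by exact_mod_cast h'
    have e : (M : ℚ) / d = (M - c) / d - ((0 : ℕ) - (c : ℚ)) / d := by
      rw [← sub_div]; simp
    rw [h'', e, abs_le]
    have h1 := Int.floor_le (((M : ℚ) - c) / d)
    have h2 := Int.lt_floor_add_one (((M : ℚ) - c) / d)
    have h3 := Int.floor_le (((0 : ℕ) - (c : ℚ)) / d)
    have h4 := Int.lt_floor_add_one (((0 : ℕ) - (c : ℚ)) / d)
    constructor <;> linarith
  generalize ((Finset.Ioc 0 M).filter (fun x ↦ x ≡ c [MOD d])).card = q at hq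
  have h2 := (Rat.cast_le (K := ℝ)).2 hq
  push_cast at h2
  exact h2

/-- Counting integers in prescribed residue classes modulo several primes. -/
lemma abs_card_residues_sub_le (R : ℕ → Finset ℕ) (M : ℕ) (P : Finset ℕ)
    (hP : ∀ l ∈ P, l.Prime) (hR : ∀ l ∈ P, R l ⊆ Finset.range l) :
    ∀ d c : ℕ, 0 < d → (∀ l ∈ P, d.Coprime l) →
    |(((Finset.Ioc 0 M).filter (fun x ↦ x ≡ c [MOD d] ∧ ∀ l ∈ P, x % l ∈ R l)).card : ℝ) -
      M / d * ∏ l ∈ P, ((R l).card / l : ℝ)| ≤ ∏ l ∈ P, ((R l).card : ℝ) := by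
  induction P using Finset.induction_on with
  | empty =>
    intro d c hd _
    simpa using abs_card_modEq_sub_le hd c M
  | insert l P hl ih =>
    intro d c hd hco
    have hlp : l.Prime := hP l (Finset.mem_insert_self l P)
    have hdl : d.Coprime l := hco l (Finset.mem_insert_self l P)
    have ih' := ih (fun q hq ↦ hP q (Finset.mem_insert_of_mem hq))
      (fun q hq ↦ hR q (Finset.mem_insert_of_mem hq))
    set S := (Finset.Ioc 0 M).filter
      (fun x ↦ x ≡ c [MOD d] ∧ ∀ q ∈ insert l P, x % q ∈ R q) with hS
    have hfib : S.card = ∑ r ∈ R l, (S.filter (fun x ↦ x % l = r)).card := by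
      refine Finset.card_eq_sum_card_fiberwise fun x hx ↦ ?_
      rw [hS, Finset.coe_filter, Set.mem_ofPred_eq] at hx
      exact hx.2.2 l (Finset.mem_insert_self l P)
    have hterm : ∀ r ∈ R l, |((S.filter (fun x ↦ x % l = r)).card : ℝ) -
        M / (d * l : ℕ) * ∏ q ∈ P, ((R q).card / q : ℝ)| ≤ ∏ q ∈ P, ((R q).card : ℝ) := by
      intro r hr
      have hrl : r < l := Finset.mem_range.1 (hR l (Finset.mem_insert_self l P) hr)
      obtain ⟨k, hk1, hk2⟩ := Nat.chineseRemainder hdl c r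
      have heq : S.filter (fun x ↦ x % l = r) = (Finset.Ioc 0 M).filter
          (fun x ↦ x ≡ k [MOD d * l] ∧ ∀ q ∈ P, x % q ∈ R q) := by
        rw [hS, Finset.filter_filter]
        refine Finset.filter_congr fun x _ ↦ ?_
        rw [← Nat.modEq_and_modEq_iff_modEq_mul hdl, Finset.forall_mem_insert]
        have hx : x % l = r ↔ x ≡ k [MOD l] := by
          rw [Nat.ModEq, hk2, Nat.mod_eq_of_lt hrl]
        have hx' : x ≡ c [MOD d] ↔ x ≡ k [MOD d] :=
          ⟨fun h ↦ h.trans hk1.symm, fun h ↦ h.trans hk1⟩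
        rw [← hx, ← hx']
        constructor
        · rintro ⟨⟨h1, -, h3⟩, h4⟩
          exact ⟨⟨h1, h4⟩, h3⟩
        · rintro ⟨⟨h1, h4⟩, h3⟩
          exact ⟨⟨h1, h4 ▸ hr, h3⟩, h4⟩
      rw [heq]
      refine ih' (d * l) k (Nat.mul_pos hd hlp.pos) fun q hq ↦ ?_
      refine Nat.Coprime.mul_left (hco q (Finset.mem_insert_of_mem hq)) ?_
      exact (Nat.coprime_primes hlp (hP q (Finset.mem_insert_of_mem hq))).2
        fun h ↦ hl (h ▸ hq)
    rw [Finset.prod_insert hl, Finset.prod_insert hl, hfib]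
    have e : (M : ℝ) / d * ((R l).card / l * ∏ q ∈ P, ((R q).card / q : ℝ)) =
        ∑ r ∈ R l, (M / (d * l : ℕ) * ∏ q ∈ P, ((R q).card / q : ℝ)) := by
      rw [Finset.sum_const, nsmul_eq_mul, Nat.cast_mul, ← div_div]
      ring
    rw [e, Nat.cast_sum, ← Finset.sum_sub_distrib]
    refine (Finset.abs_sum_le_sum_abs _ _).trans ?_
    exact (Finset.sum_le_sum hterm).trans_eq (by rw [Finset.sum_const, nsmul_eq_mul])

/-- The inclusion-exclusion sum truncated at sets of size `k`. -/
noncomputable def truncIncl (P : Finset ℕ) (k : ℕ) (x : ℕ → ℝ) : ℝ :=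
  ∑ D ∈ P.powerset, if D.card ≤ k then (-1) ^ D.card * ∏ l ∈ D, x l else 0

lemma truncIncl_insert {P : Finset ℕ} {l : ℕ} (hl : l ∉ P) (k : ℕ) (x : ℕ → ℝ) :
    truncIncl (insert l P) (k + 1) x = truncIncl P (k + 1) x - x l * truncIncl P k x := by
  rw [truncIncl, Finset.sum_powerset_insert hl, truncIncl, sub_eq_add_neg, truncIncl,
    Finset.mul_sum, ← Finset.sum_neg_distrib]
  congr 1
  refine Finset.sum_congr rfl fun D hD ↦ ?_
  have hlD : l ∉ D := fun h ↦ hl (Finset.mem_powerset.1 hD h)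
  rw [Finset.card_insert_of_notMem hlD, Finset.prod_insert hlD]
  by_cases h : D.card ≤ k
  · rw [if_pos (by omega), if_pos h]
    ring
  · rw [if_neg (by omega), if_neg h]
    ring

lemma truncIncl_zero (P : Finset ℕ) (x : ℕ → ℝ) : truncIncl P 0 x = 1 := by
  rw [truncIncl, Finset.sum_eq_single ∅]
  · simp
  · intro D _ hD
    rw [if_neg]
    simpa using hD
  · simp

/-- Bonferroni inequalities. -/
lemma bonferroni (x : ℕ → ℝ) (P : Finset ℕ) (h0 : ∀ l ∈ P, 0 ≤ x l) (h1 : ∀ l ∈ P, x l ≤ 1) :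
    ∀ k : ℕ, 0 ≤ (-1) ^ k * (truncIncl P k x - ∏ l ∈ P, (1 - x l)) := by
  induction P using Finset.induction_on with
  | empty => intro k; simp [truncIncl]
  | insert l P hl ih =>
    have ih' := ih (fun q hq ↦ h0 q (Finset.mem_insert_of_mem hq))
      (fun q hq ↦ h1 q (Finset.mem_insert_of_mem hq))
    have hl0 := h0 l (Finset.mem_insert_self l P)
    intro k
    cases k with
    | zero =>
      rw [truncIncl_zero, pow_zero, one_mul, sub_nonneg]
      refine Finset.prod_le_one (fun q hq ↦ ?_) fun q hq ↦ ?_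
      · linarith [h1 q hq]
      · linarith [h0 q hq]
    | succ k =>
      rw [truncIncl_insert hl, Finset.prod_insert hl]
      have e : (-1) ^ (k + 1) * (truncIncl P (k + 1) x - x l * truncIncl P k x -
          (1 - x l) * ∏ q ∈ P, (1 - x q)) =
          (-1) ^ (k + 1) * (truncIncl P (k + 1) x - ∏ q ∈ P, (1 - x q)) +
          x l * ((-1) ^ k * (truncIncl P k x - ∏ q ∈ P, (1 - x q))) := by
        rw [pow_succ]; ring
      rw [e]
      exact add_nonneg (ih' _) (mul_nonneg hl0 (ih' _))

lemma truncIncl_le (x : ℕ → ℝ) (P : Finset ℕ) (h0 : ∀ l ∈ P, 0 ≤ x l) (k : ℕ) :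
    truncIncl P k x ≤ ∏ l ∈ P, (1 - x l) + exp (-k) * ∏ l ∈ P, (1 + exp 1 * x l) := by
  have e1 : ∏ l ∈ P, (1 - x l) = ∑ D ∈ P.powerset, (-1) ^ D.card * ∏ l ∈ D, x l := by
    simp_rw [sub_eq_add_neg]
    rw [Finset.prod_one_add]
    refine Finset.sum_congr rfl fun D _ ↦ ?_
    rw [Finset.prod_neg]
  rw [e1, Finset.prod_one_add, Finset.mul_sum, ← Finset.sum_add_distrib, truncIncl]
  refine Finset.sum_le_sum fun D hD ↦ ?_
  have hD0 : 0 ≤ ∏ l ∈ D, x l :=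
    Finset.prod_nonneg fun l hl ↦ h0 l (Finset.mem_powerset.1 hD hl)
  rw [Finset.prod_mul_distrib, Finset.prod_const]
  split_ifs with h
  · have : 0 ≤ exp (-k) * (exp 1 ^ D.card * ∏ l ∈ D, x l) := by positivity
    linarith
  · have h2 : 1 ≤ exp (-k) * exp 1 ^ D.card := by
      rw [← exp_nat_mul, ← exp_add, one_le_exp_iff]
      have : (k : ℝ) ≤ D.card := by exact_mod_cast (by omega : k ≤ D.card)
      linarith
    have h3 : (1 : ℝ) * ∏ l ∈ D, x l ≤ exp (-k) * exp 1 ^ D.card * ∏ l ∈ D, x l := by gcongr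
    have h4 : -∏ l ∈ D, x l ≤ (-1) ^ D.card * ∏ l ∈ D, x l := by
      rcases neg_one_pow_eq_or ℝ D.card with h | h <;> rw [h] <;> linarith
    linarith

/-- The pure sieve of Brun. -/
lemma brun_sieve (R : ℕ → Finset ℕ) (M : ℕ) (P : Finset ℕ)
    (hP : ∀ l ∈ P, l.Prime) (hR : ∀ l ∈ P, R l ⊆ Finset.range l) {k : ℕ} (hk : Even k)
    {s : ℝ} (hs : 1 ≤ s) :
    (((Finset.Ioc 0 M).filter (fun x ↦ ∀ l ∈ P, x % l ∉ R l)).card : ℝ) ≤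
      M * (∏ l ∈ P, (1 - (R l).card / (l : ℝ)) +
        exp (-k) * ∏ l ∈ P, (1 + exp 1 * ((R l).card / (l : ℝ)))) +
      s ^ k * ∏ l ∈ P, (1 + (R l).card / s) := by
  set I : ℕ → ℕ → ℝ := fun n l ↦ if n % l ∈ R l then 1 else 0 with hI
  have hI0 : ∀ n l, 0 ≤ I n l := fun n l ↦ by rw [hI]; dsimp only; split_ifs <;> norm_num
  have hI1 : ∀ n l, I n l ≤ 1 := fun n l ↦ by rw [hI]; dsimp only; split_ifs <;> norm_num
  have h1 : (((Finset.Ioc 0 M).filter (fun x ↦ ∀ l ∈ P, x % l ∉ R l)).card : ℝ) ≤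
      ∑ n ∈ Finset.Ioc 0 M, truncIncl P k (I n) := by
    rw [Finset.card_filter]
    push_cast
    refine Finset.sum_le_sum fun n _ ↦ ?_
    have hb := bonferroni (I n) P (fun l _ ↦ hI0 n l) (fun l _ ↦ hI1 n l) k
    rw [hk.neg_one_pow, one_mul, sub_nonneg] at hb
    refine le_trans ?_ hb
    split_ifs with h
    · rw [Finset.prod_eq_one]
      intro l hl
      rw [hI]
      simp [h l hl]
    · exact Finset.prod_nonneg fun l _ ↦ by linarith [hI1 n l]
  have h2 : ∀ D ∈ P.powerset,
      |∑ n ∈ Finset.Ioc 0 M, ∏ l ∈ D, I n l - M * ∏ l ∈ D, ((R l).card / l : ℝ)| ≤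
      ∏ l ∈ D, ((R l).card : ℝ) := by
    intro D hD
    have hsub := Finset.mem_powerset.1 hD
    have h := abs_card_residues_sub_le R M D (fun l hl ↦ hP l (hsub hl))
      (fun l hl ↦ hR l (hsub hl)) 1 0 one_pos (fun l _ ↦ Nat.coprime_one_left l)
    have e : ∑ n ∈ Finset.Ioc 0 M, ∏ l ∈ D, I n l = (((Finset.Ioc 0 M).filter
        (fun x ↦ x ≡ 0 [MOD 1] ∧ ∀ l ∈ D, x % l ∈ R l)).card : ℝ) := by
      rw [Finset.card_filter]
      push_cast
      refine Finset.sum_congr rfl fun n _ ↦ ?_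
      rw [hI]
      dsimp only
      rw [Finset.prod_ite_zero]
      simp [Nat.modEq_one]
    rw [e]
    simpa using h
  have h3 : ∑ n ∈ Finset.Ioc 0 M, truncIncl P k (I n) ≤
      M * truncIncl P k (fun l ↦ (R l).card / (l : ℝ)) + s ^ k * ∏ l ∈ P, (1 + (R l).card / s) := by
    simp only [truncIncl]
    rw [Finset.sum_comm, Finset.prod_one_add, Finset.mul_sum, Finset.mul_sum,
      ← Finset.sum_add_distrib]
    refine Finset.sum_le_sum fun D hD ↦ ?_
    have hc : ∏ l ∈ D, ((R l).card / s : ℝ) = (∏ l ∈ D, ((R l).card : ℝ)) / s ^ D.card := by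
      rw [Finset.prod_div_distrib, Finset.prod_const]
    have hc0 : (0 : ℝ) ≤ ∏ l ∈ D, ((R l).card : ℝ) := Finset.prod_nonneg fun _ _ ↦ Nat.cast_nonneg _
    have hs0 : 0 < s := one_pos.trans_le hs
    split_ifs with h
    · rw [← Finset.mul_sum, hc]
      have h4 : ∏ l ∈ D, ((R l).card : ℝ) ≤ s ^ k * ((∏ l ∈ D, ((R l).card : ℝ)) / s ^ D.card) := by
        have : s ^ k = s ^ (k - D.card) * s ^ D.card := by rw [← pow_add, Nat.sub_add_cancel h]
        have hsD : s ^ D.card ≠ 0 := by positivity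
        rw [this, mul_assoc, mul_div_cancel₀ _ hsD]
        exact le_mul_of_one_le_left hc0 (one_le_pow₀ hs)
      have h5 := abs_le.1 (h2 D hD)
      clear_value I
      clear h2 h1 hc
      revert h4 h5
      generalize ∑ n ∈ Finset.Ioc 0 M, ∏ l ∈ D, I n l = u1
      generalize ∏ l ∈ D, ((R l).card / l : ℝ) = u2
      generalize s ^ k * ((∏ l ∈ D, ((R l).card : ℝ)) / s ^ D.card) = u3
      generalize ∏ l ∈ D, ((R l).card : ℝ) = u4
      rintro h4 ⟨h5, h6⟩
      rcases neg_one_pow_eq_or ℝ D.card with h | h <;> rw [h] <;> linarith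
    · simp only [Finset.sum_const_zero, mul_zero, zero_add]
      rw [hc]
      exact mul_nonneg (pow_nonneg hs0.le _) (div_nonneg hc0 (pow_nonneg hs0.le _))
  refine h1.trans (h3.trans ?_)
  gcongr
  exact truncIncl_le _ P (fun l _ ↦ by positivity) k

lemma card_primeFactors_mul_log_two_le {n : ℕ} (hn : n ≠ 0) :
    (n.primeFactors.card : ℝ) * log 2 ≤ log n := by
  have h : 2 ^ n.primeFactors.card ≤ n :=
    (Finset.pow_card_le_prod _ _ _ fun p hp ↦ (Nat.prime_of_mem_primeFactors hp).two_le).trans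
      (Nat.le_of_dvd (Nat.pos_of_ne_zero hn) (Nat.prod_primeFactors_dvd n))
  rw [← log_pow]
  exact log_le_log (by positivity) (by exact_mod_cast h)

lemma exp_sum_primeFactors_inv_le : ∃ C : ℝ, 0 < C ∧ ∀ (X : ℝ) (n : ℕ), 2 ≤ X → n ≠ 0 →
    log n ≤ 2 * X → exp (∑ p ∈ n.primeFactors, 1 / (p : ℝ)) ≤ C * log X := by
  obtain ⟨C, hC, h⟩ := exp_sum_primes_inv_le
  refine ⟨C * exp 3, by positivity, fun X n hX hn hlog ↦ ?_⟩
  have hX0 : 0 < X := by linarith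
  have hf : 2 ≤ ⌊X⌋₊ := Nat.le_floor hX
  rw [← Finset.sum_filter_add_sum_filter_not _ (fun p ↦ p ≤ ⌊X⌋₊), exp_add]
  have h1 : exp (∑ p ∈ n.primeFactors with p ≤ ⌊X⌋₊, 1 / (p : ℝ)) ≤ C * log X := by
    refine le_trans (exp_le_exp.2 ?_) ((h _ hf).trans ?_)
    · refine Finset.sum_le_sum_of_subset_of_nonneg (fun p hp ↦ ?_) fun _ _ _ ↦ by positivity
      rw [Finset.mem_filter] at hp
      exact Nat.mem_primesBelow.2 ⟨by omega, Nat.prime_of_mem_primeFactors hp.1⟩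
    · gcongr
      exact Nat.floor_le hX0.le
  have h2 : ∑ p ∈ n.primeFactors with ¬ p ≤ ⌊X⌋₊, 1 / (p : ℝ) ≤ 3 := by
    calc ∑ p ∈ n.primeFactors with ¬ p ≤ ⌊X⌋₊, 1 / (p : ℝ)
        ≤ ∑ p ∈ n.primeFactors with ¬ p ≤ ⌊X⌋₊, 1 / X := by
          refine Finset.sum_le_sum fun p hp ↦ ?_
          rw [Finset.mem_filter, not_le, Nat.floor_lt hX0.le] at hp
          exact one_div_le_one_div_of_le hX0 hp.2.le
      _ ≤ n.primeFactors.card * (1 / X) := by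
          rw [Finset.sum_const, nsmul_eq_mul]
          gcongr
          exact Finset.filter_subset _ _
      _ ≤ 3 := by
          have h3 := card_primeFactors_mul_log_two_le hn
          have h4 := log_two_gt_d9
          rw [mul_one_div, div_le_iff₀ hX0]
          nlinarith [Nat.cast_nonneg (α := ℝ) n.primeFactors.card]
  have h0 : 0 ≤ log X := log_nonneg (by linarith)
  calc _ ≤ (C * log X) * exp 3 := by gcongr
    _ = _ := by ring

/-- The residues `x` mod `l` for which `l` divides `x (a² + (mx)²)`. -/
def badResidues (a m l : ℕ) : Finset ℕ :=
  (Finset.range l).filter fun x ↦ (x : ZMod l) = 0 ∨ (a : ZMod l) ^ 2 + (m * x) ^ 2 = 0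

lemma card_badResidues_le {a m l : ℕ} (hl : l.Prime) (hm : ¬ l ∣ m) :
    (badResidues a m l).card ≤ 3 := by
  have := Fact.mk hl
  have hinj : Set.InjOn (fun x : ℕ ↦ (x : ZMod l)) (badResidues a m l) := by
    intro x hx y hy hxy
    simp only [badResidues, Finset.coe_filter, Set.mem_ofPred_eq, Finset.mem_range] at hx hy
    have := (ZMod.natCast_eq_natCast_iff' _ _ _).1 hxy
    rwa [Nat.mod_eq_of_lt hx.1, Nat.mod_eq_of_lt hy.1] at this
  have hm0 : (m : ZMod l) ≠ 0 := by rwa [Ne, ZMod.natCast_eq_zero_iff]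
  rw [← Finset.card_image_of_injOn hinj]
  by_cases hr : ∃ r : ZMod l, (a : ZMod l) ^ 2 + (m * r) ^ 2 = 0
  · obtain ⟨r, hr⟩ := hr
    refine le_trans (Finset.card_le_card (t := {0, r, -r}) fun y hy ↦ ?_) Finset.card_le_three
    obtain ⟨x, hx, rfl⟩ := Finset.mem_image.1 hy
    rw [badResidues, Finset.mem_filter] at hx
    simp only [Finset.mem_insert, Finset.mem_singleton]
    refine hx.2.imp_right fun h ↦ ?_
    have : (m : ZMod l) ^ 2 * ((x : ZMod l) ^ 2 - r ^ 2) = 0 := by linear_combination h - hr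
    rw [← sq_eq_sq_iff_eq_or_eq_neg, ← sub_eq_zero]
    exact (mul_eq_zero.1 this).resolve_left (pow_ne_zero _ hm0)
  · refine le_trans (Finset.card_le_card (t := {0}) fun y hy ↦ ?_) (by simp)
    obtain ⟨x, hx, rfl⟩ := Finset.mem_image.1 hy
    rw [badResidues, Finset.mem_filter] at hx
    exact Finset.mem_singleton.2 (hx.2.resolve_right fun h ↦ hr ⟨_, h⟩)

lemma le_card_badResidues {a m l : ℕ} (hl : l.Prime) (hl2 : l ≠ 2) (ha : ¬ l ∣ a) (hm : ¬ l ∣ m) :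
    2 + (ZMod.χ₄ l : ℝ) ≤ (badResidues a m l).card := by
  have := Fact.mk hl
  have hm0 : (m : ZMod l) ≠ 0 := by rwa [Ne, ZMod.natCast_eq_zero_iff]
  have ha0 : (a : ZMod l) ≠ 0 := by rwa [Ne, ZMod.natCast_eq_zero_iff]
  have hodd := hl.eq_two_or_odd.resolve_left hl2
  rcases (by omega : l % 4 = 1 ∨ l % 4 = 3) with h | h
  · rw [ZMod.χ₄_nat_one_mod_four h]
    obtain ⟨i, hi⟩ := ZMod.exists_sq_eq_neg_one_iff.2 (by omega : l % 4 ≠ 3)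
    have h20 : (2 : ZMod l) ≠ 0 := by
      have : ((2 : ℕ) : ZMod l) ≠ 0 := by
        rw [Ne, ZMod.natCast_eq_zero_iff, Nat.prime_dvd_prime_iff_eq hl Nat.prime_two]
        exact hl2
      exact_mod_cast this
    have hi0 : i ≠ 0 := by
      rintro rfl
      simp at hi
    have hr0 : i * a / m ≠ 0 := div_ne_zero (mul_ne_zero hi0 ha0) hm0
    have hroot : ∀ r : ZMod l, (r = i * a / m ∨ r = -(i * a / m)) →
        (a : ZMod l) ^ 2 + (m * r) ^ 2 = 0 := by
      rintro r (rfl | rfl)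
      · field_simp
        linear_combination -(a : ZMod l) ^ 2 * hi
      · field_simp
        linear_combination -(a : ZMod l) ^ 2 * hi
    have hc : ({0, i * a / m, -(i * a / m)} : Finset (ZMod l)).card = 3 := by
      refine Finset.card_eq_three.2 ⟨_, _, _, hr0.symm, (neg_ne_zero.2 hr0).symm, fun h ↦ ?_, rfl⟩
      have : 2 * (i * a / m) = 0 := by linear_combination h
      exact hr0 ((mul_eq_zero.1 this).resolve_left h20)
    have : 3 ≤ (badResidues a m l).card := by
      rw [← hc, ← Finset.card_image_of_injective _ (ZMod.val_injective l)]
      refine Finset.card_le_card fun y hy ↦ ?_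
      obtain ⟨r, hr, rfl⟩ := Finset.mem_image.1 hy
      rw [badResidues, Finset.mem_filter, Finset.mem_range, ZMod.natCast_zmod_val]
      simp only [Finset.mem_insert, Finset.mem_singleton] at hr
      exact ⟨ZMod.val_lt _, hr.imp_right (hroot r)⟩
    have : (3 : ℝ) ≤ (badResidues a m l).card := by exact_mod_cast this
    push_cast
    linarith
  · rw [ZMod.χ₄_nat_three_mod_four h]
    have : 1 ≤ (badResidues a m l).card := Finset.card_pos.2 ⟨0, by
      simp [badResidues, hl.pos]⟩
    have : (1 : ℝ) ≤ (badResidues a m l).card := by exact_mod_cast this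
    push_cast
    linarith

/-- Primes `q ≤ M` exceeding `w` for which `a² + (mq)²` is twice a prime. -/
def primePairs (a m w M : ℕ) : Set ℕ :=
  {q | q ≤ M ∧ w < q ∧ q.Prime ∧ ∃ p : ℕ, p.Prime ∧ a ^ 2 + (m * q) ^ 2 = 2 * p}

/-- The odd primes up to `w` that do not divide `n`. -/
def sievingPrimes (n w : ℕ) : Finset ℕ :=
  (w + 1).primesBelow.filter fun l ↦ l ≠ 2 ∧ ¬ l ∣ n

lemma mem_sievingPrimes {n w l : ℕ} :
    l ∈ sievingPrimes n w ↔ (l ≤ w ∧ l.Prime) ∧ l ≠ 2 ∧ ¬ l ∣ n := by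
  rw [sievingPrimes, Finset.mem_filter, Nat.mem_primesBelow, Nat.lt_succ_iff]

lemma mod_notMem_badResidues {a m w M q l : ℕ} (hm : m ≠ 0) (hq : q ∈ primePairs a m w M)
    (hl : l ∈ sievingPrimes (a * m) w) : q % l ∉ badResidues a m l := by
  obtain ⟨-, hwq, hqp, p, hp, h⟩ := hq
  obtain ⟨⟨hlw, hlp⟩, hl2, -⟩ := mem_sievingPrimes.1 hl
  rw [badResidues, Finset.mem_filter, ZMod.natCast_mod]
  rintro ⟨-, h0 | h0⟩
  · rw [ZMod.natCast_eq_zero_iff, Nat.prime_dvd_prime_iff_eq hlp hqp] at h0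
    omega
  · have h1 : ((2 * p : ℕ) : ZMod l) = 0 := by
      rw [← h]
      push_cast
      exact h0
    rw [ZMod.natCast_eq_zero_iff, hlp.dvd_mul, Nat.prime_dvd_prime_iff_eq hlp Nat.prime_two,
      Nat.prime_dvd_prime_iff_eq hlp hp] at h1
    obtain rfl := h1.resolve_left hl2
    have h2 : q ≤ m * q := Nat.le_mul_of_pos_left _ (Nat.pos_of_ne_zero hm)
    have := hlp.two_le
    nlinarith

lemma sum_primesBelow_le_sum_sievingPrimes {n : ℕ} (hn : n ≠ 0) (w : ℕ) :
    ∑ l ∈ (w + 1).primesBelow, 1 / (l : ℝ) +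
        ∑ l ∈ (w + 1).primesBelow, (1 + (ZMod.χ₄ l : ℝ)) / (l : ℝ) ≤
      ∑ l ∈ sievingPrimes n w, (2 + (ZMod.χ₄ l : ℝ)) / l + 3 / 2 +
        3 * ∑ l ∈ n.primeFactors, 1 / (l : ℝ) := by
  have hchi : ∀ l : ℕ, 0 ≤ 2 + (ZMod.χ₄ l : ℝ) ∧ 2 + (ZMod.χ₄ l : ℝ) ≤ 3 := fun l ↦ by
    rcases chi_values l with h | h | h <;> rw [h] <;> norm_num
  have e : ∑ l ∈ (w + 1).primesBelow, 1 / (l : ℝ) +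
        ∑ l ∈ (w + 1).primesBelow, (1 + (ZMod.χ₄ l : ℝ)) / (l : ℝ) =
      ∑ l ∈ (w + 1).primesBelow, (2 + (ZMod.χ₄ l : ℝ)) / (l : ℝ) := by
    rw [← Finset.sum_add_distrib]
    exact Finset.sum_congr rfl fun l _ ↦ by ring
  have hsub : (w + 1).primesBelow ⊆ sievingPrimes n w ∪ ({2} ∪ n.primeFactors) := fun l hl ↦ by
    rw [Nat.mem_primesBelow] at hl
    rw [Finset.mem_union, Finset.mem_union, mem_sievingPrimes, Finset.mem_singleton,
      Nat.mem_primeFactors]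
    have := hl.2
    have : l ≤ w := by omega
    tauto
  have hun : ∀ (s t : Finset ℕ) (f : ℕ → ℝ), (∀ i, 0 ≤ f i) →
      ∑ i ∈ s ∪ t, f i ≤ ∑ i ∈ s, f i + ∑ i ∈ t, f i := fun s t f hf ↦ by
    rw [← Finset.sum_union_inter]
    exact le_add_of_nonneg_right (Finset.sum_nonneg fun i _ ↦ hf i)
  have hf : ∀ l : ℕ, 0 ≤ (2 + (ZMod.χ₄ l : ℝ)) / (l : ℝ) := fun l ↦
    div_nonneg (hchi l).1 (Nat.cast_nonneg l)
  have h2 : ∑ l ∈ ({2} : Finset ℕ), (2 + (ZMod.χ₄ l : ℝ)) / (l : ℝ) ≤ 3 / 2 := by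
    rw [Finset.sum_singleton]
    have := (hchi 2).2
    push_cast at this ⊢
    linarith
  have h3 : ∑ l ∈ n.primeFactors, (2 + (ZMod.χ₄ l : ℝ)) / (l : ℝ) ≤
      3 * ∑ l ∈ n.primeFactors, 1 / (l : ℝ) := by
    rw [Finset.mul_sum]
    refine Finset.sum_le_sum fun l _ ↦ ?_
    rw [mul_one_div]
    gcongr
    exact (hchi l).2
  rw [e]
  refine (Finset.sum_le_sum_of_subset_of_nonneg hsub fun l _ _ ↦ hf l).trans ?_
  refine (hun _ _ _ hf).trans ?_
  linarith [hun {2} n.primeFactors _ hf]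

/-- A sieve bound for `primePairs`. -/
lemma ncard_primePairs_le_of_even : ∃ C : ℝ, 0 < C ∧ ∀ a m w M k : ℕ, a ≠ 0 → m ≠ 0 → 2 ≤ w →
    Even k → ((primePairs a m w M).ncard : ℝ) ≤
      C * (M * (exp (∑ l ∈ (a * m).primeFactors, 1 / (l : ℝ)) ^ 3 / log w ^ 2 +
        exp (-k) * log w ^ 9) + (w : ℝ) ^ k) := by
  obtain ⟨C₁, hC₁, h₁⟩ := log_le_exp_sum_primes_inv
  obtain ⟨C₂, hC₂, h₂⟩ := log_le_exp_sum_chi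
  obtain ⟨C₃, hC₃, h₃⟩ := exp_sum_primes_inv_le
  refine ⟨max (C₁ * C₂ * exp (3 / 2)) (max (C₃ ^ 9) (exp 3)), by positivity,
    fun a m w M k ha hm hw hk ↦ ?_⟩
  have hw0 : (0 : ℝ) < w := by positivity
  have hlog : 0 < log w := log_pos (by exact_mod_cast hw)
  set P := sievingPrimes (a * m) w with hPdef
  have hP : ∀ l ∈ P, l.Prime := fun l hl ↦ (mem_sievingPrimes.1 hl).1.2
  have hsub : P ⊆ (w + 1).primesBelow := Finset.filter_subset _ _
  have hPa : ∀ l ∈ P, ¬ l ∣ a := fun l hl h ↦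
    (mem_sievingPrimes.1 hl).2.2 (dvd_mul_of_dvd_left h _)
  have hPm : ∀ l ∈ P, ¬ l ∣ m := fun l hl h ↦
    (mem_sievingPrimes.1 hl).2.2 (dvd_mul_of_dvd_right h _)
  have hsieve := brun_sieve (badResidues a m) M P hP (fun l _ ↦ Finset.filter_subset _ _) hk
    (s := w) (by exact_mod_cast (by omega : 1 ≤ w))
  have hcard : ((primePairs a m w M).ncard : ℝ) ≤ (((Finset.Ioc 0 M).filter
      (fun x ↦ ∀ l ∈ P, x % l ∉ badResidues a m l)).card : ℝ) := by
    rw [← Set.ncard_coe_finset]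
    refine Nat.cast_le.2 (Set.ncard_le_ncard (fun q hq ↦ ?_) (Finset.finite_toSet _))
    rw [Finset.mem_coe, Finset.mem_filter, Finset.mem_Ioc]
    exact ⟨⟨hq.2.2.1.pos, hq.1⟩, fun l hl ↦ mod_notMem_badResidues hm hq hl⟩
  have hR3 : ∀ l ∈ P, ((badResidues a m l).card : ℝ) ≤ 3 := fun l hl ↦ by
    exact_mod_cast card_badResidues_le (hP l hl) (hPm l hl)
  have hmain : ∏ l ∈ P, (1 - ((badResidues a m l).card : ℝ) / l) ≤
      C₁ * C₂ * exp (3 / 2) *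
        (exp (∑ l ∈ (a * m).primeFactors, 1 / (l : ℝ)) ^ 3 / log w ^ 2) := by
    have hs := sum_primesBelow_le_sum_sievingPrimes (mul_ne_zero ha hm) w
    rw [← hPdef] at hs
    have h4 : ∏ l ∈ P, (1 - ((badResidues a m l).card : ℝ) / l) ≤
        exp (-∑ l ∈ P, (2 + (ZMod.χ₄ l : ℝ)) / l) := by
      rw [← Finset.sum_neg_distrib, exp_sum]
      refine Finset.prod_le_prod (fun l hl ↦ ?_) fun l hl ↦ ?_
      · have h5 : (badResidues a m l).card ≤ l :=
          (Finset.card_filter_le _ _).trans_eq (Finset.card_range l)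
        rw [sub_nonneg]
        exact div_le_one_of_le₀ (by exact_mod_cast h5) (Nat.cast_nonneg l)
      · have h5 := le_card_badResidues (hP l hl) (mem_sievingPrimes.1 hl).2.1 (hPa l hl) (hPm l hl)
        have h6 : (2 + (ZMod.χ₄ l : ℝ)) / l ≤ ((badResidues a m l).card : ℝ) / l := by gcongr
        linarith [add_one_le_exp (-((2 + (ZMod.χ₄ l : ℝ)) / l))]
    have hw1 : log w ≤ log (w + 1) := log_le_log hw0 (by linarith)
    have h5 := hw1.trans (h₁ w)
    have h6 := hw1.trans (h₂ w)
    revert hs h4 h5 h6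
    generalize ∑ l ∈ P, (2 + (ZMod.χ₄ l : ℝ)) / l = s
    generalize ∑ l ∈ (w + 1).primesBelow, 1 / (l : ℝ) = s1
    generalize ∑ l ∈ (w + 1).primesBelow, (1 + (ZMod.χ₄ l : ℝ)) / (l : ℝ) = s2
    generalize ∑ l ∈ (a * m).primeFactors, 1 / (l : ℝ) = s3
    intro hs h4 h5 h6
    refine h4.trans ?_
    have h7 : log w ^ 2 ≤ C₁ * C₂ * exp (s1 + s2) := by
      rw [exp_add, pow_two]
      calc log w * log w ≤ (C₁ * exp s1) * (C₂ * exp s2) := by gcongr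
        _ = _ := by ring
    rw [← mul_div_assoc, le_div_iff₀ (by positivity)]
    calc exp (-s) * log w ^ 2 ≤ exp (-s) * (C₁ * C₂ * exp (s1 + s2)) := by gcongr
      _ = C₁ * C₂ * exp (s1 + s2 - s) := by
        rw [sub_eq_add_neg, exp_add (s1 + s2)]
        ring
      _ ≤ C₁ * C₂ * exp (3 / 2 + 3 * s3) := by
        gcongr
        linarith
      _ = C₁ * C₂ * exp (3 / 2) * exp s3 ^ 3 := by
        rw [exp_add, ← exp_nat_mul]
        push_cast
        ring
  have htail : ∏ l ∈ P, (1 + exp 1 * (((badResidues a m l).card : ℝ) / l)) ≤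
      C₃ ^ 9 * log w ^ 9 := by
    calc ∏ l ∈ P, (1 + exp 1 * (((badResidues a m l).card : ℝ) / l))
        ≤ ∏ l ∈ P, exp (9 * (1 / (l : ℝ))) := by
          refine Finset.prod_le_prod (fun l _ ↦ by positivity) fun l hl ↦ ?_
          have h4 : exp 1 * (((badResidues a m l).card : ℝ) / l) ≤ 3 * (3 / l) := by
            gcongr
            · exact exp_one_lt_three.le
            · exact hR3 l hl
          have h5 : 9 * (1 / (l : ℝ)) = 3 * (3 / l) := by ring
          rw [h5]
          linarith [add_one_le_exp (3 * (3 / (l : ℝ)))]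
      _ = exp (∑ l ∈ P, 1 / (l : ℝ)) ^ 9 := by
          rw [← exp_sum, ← Finset.mul_sum, ← exp_nat_mul]
          norm_num
      _ ≤ exp (∑ l ∈ (w + 1).primesBelow, 1 / (l : ℝ)) ^ 9 := by gcongr
      _ ≤ (C₃ * log w) ^ 9 := by
          gcongr
          exact h₃ w hw
      _ = _ := mul_pow _ _ _
  have herr : ∏ l ∈ P, (1 + ((badResidues a m l).card : ℝ) / w) ≤ exp 3 := by
    calc ∏ l ∈ P, (1 + ((badResidues a m l).card : ℝ) / w) ≤ ∏ l ∈ P, exp (3 / w) := by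
          refine Finset.prod_le_prod (fun l _ ↦ by positivity) fun l hl ↦ ?_
          have h4 : ((badResidues a m l).card : ℝ) / w ≤ 3 / w := by
            gcongr
            exact hR3 l hl
          linarith [add_one_le_exp (3 / (w : ℝ))]
      _ = exp (P.card * (3 / w)) := by
          rw [Finset.prod_const, ← exp_nat_mul]
      _ ≤ exp 3 := by
          have h4 : P ⊆ Finset.Ioc 0 w := fun l hl ↦ Finset.mem_Ioc.2
            ⟨(hP l hl).pos, (mem_sievingPrimes.1 hl).1.1⟩
          have h5 : (P.card : ℝ) ≤ w := by
            have := Finset.card_le_card h4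
            rw [Nat.card_Ioc] at this
            exact_mod_cast this
          rw [exp_le_exp, mul_div_assoc', div_le_iff₀ hw0]
          linarith
  refine hcard.trans (hsieve.trans ?_)
  set C := max (C₁ * C₂ * exp (3 / 2)) (max (C₃ ^ 9) (exp 3)) with hC
  have hc1 : C₁ * C₂ * exp (3 / 2) ≤ C := le_max_left _ _
  have hc2 : C₃ ^ 9 ≤ C := (le_max_left _ _).trans (le_max_right _ _)
  have hc3 : exp 3 ≤ C := (le_max_right _ _).trans (le_max_right _ _)
  calc _ ≤ M * (C * (exp (∑ l ∈ (a * m).primeFactors, 1 / (l : ℝ)) ^ 3 / log w ^ 2) +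
        exp (-k) * (C * log w ^ 9)) + (w : ℝ) ^ k * C := by
        gcongr
        · exact hmain.trans (by gcongr)
        · exact htail.trans (by gcongr)
        · exact herr.trans hc3
    _ = _ := by ring

/-- The sieve bound for large primes `q ≤ M` such that `a² + (mq)²` is twice a prime. -/
lemma ncard_large_prime_le : ∃ C : ℝ, 0 < C ∧ ∀ (X : ℝ) (a m M : ℕ), a ≠ 0 → m ≠ 0 →
    1 ≤ log X → 560 * log X ^ 2 ≤ X → log (a * m : ℕ) ≤ 2 * X →
    (({q : ℕ | q ≤ M ∧ exp (X / (20 * log X)) < q ∧ q.Prime ∧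
      ∃ p : ℕ, p.Prime ∧ a ^ 2 + (m * q) ^ 2 = 2 * p}).ncard : ℝ) ≤
      C * (M * log X ^ 7 / X ^ 2) := by
  obtain ⟨C₁, hC₁, h₁⟩ := exp_sum_primeFactors_inv_le
  obtain ⟨C₂, hC₂, h₂⟩ := ncard_primePairs_le_of_even
  refine ⟨C₂ * (4 * 560 ^ 2 * C₁ ^ 3 + 2), by positivity, fun X a m M ha hm hL hX hlog ↦ ?_⟩
  set L := log X with hLdef
  have hX1 : 560 ≤ X := by nlinarith
  have hX0 : 0 < X := by linarith
  have hXL : exp L = X := exp_log hX0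
  set S := {q : ℕ | q ≤ M ∧ exp (X / (20 * L)) < q ∧ q.Prime ∧
      ∃ p : ℕ, p.Prime ∧ a ^ 2 + (m * q) ^ 2 = 2 * p} with hS
  rcases lt_or_ge (M : ℝ) (exp (X / (20 * L))) with hM | hM
  · have : S = ∅ := by
      refine Set.eq_empty_iff_forall_notMem.2 fun q hq ↦ ?_
      have : (q : ℝ) ≤ M := by exact_mod_cast hq.1
      linarith [hq.2.1]
    rw [this, Set.ncard_empty]
    push_cast
    positivity
  set T := X / (560 * L ^ 2) with hT
  have hT1 : 1 ≤ T := by rwa [hT, one_le_div (by positivity)]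
  set w := ⌊exp T⌋₊ with hw
  have hw2 : 2 ≤ w := Nat.le_floor (by
    push_cast
    linarith [add_one_le_exp T])
  have hwT : (w : ℝ) ≤ exp T := Nat.floor_le (exp_pos _).le
  have hw0 : (0 : ℝ) < w := by positivity
  have hwr : (2 : ℝ) ≤ w := by exact_mod_cast hw2
  have hlogw : T / 2 ≤ log w := by
    have h3 : exp T ≤ (w : ℝ) ^ 2 := by
      have := Nat.lt_floor_add_one (exp T)
      rw [← hw] at this
      nlinarith
    have h4 := log_le_log (exp_pos _) h3
    rw [log_exp, log_pow] at h4
    push_cast at h4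
    linarith
  have hlogwX : log w ≤ X := by
    have h3 := log_le_log hw0 hwT
    rw [log_exp] at h3
    refine h3.trans (div_le_self hX0.le ?_)
    nlinarith
  have hsub : S ⊆ primePairs a m w M := fun q hq ↦ by
    refine ⟨hq.1, ?_, hq.2.2⟩
    have h3 : T ≤ X / (20 * L) := by
      rw [hT]
      refine div_le_div_of_nonneg_left hX0.le (by positivity) ?_
      nlinarith
    have : (w : ℝ) < q := (hwT.trans (exp_le_exp.2 h3)).trans_lt hq.2.1
    exact_mod_cast this
  have hfin : (primePairs a m w M).Finite := (Set.finite_Iic M).subset fun q hq ↦ hq.1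
  have hk := h₂ a m w M (2 * ⌈6 * L⌉₊) ha hm hw2 (even_two_mul _)
  set k := 2 * ⌈6 * L⌉₊ with hkdef
  have hk1 : 12 * L ≤ k := by
    have := Nat.le_ceil (6 * L)
    rw [hkdef]
    push_cast
    linarith
  have hk2 : (k : ℝ) ≤ 14 * L := by
    have := Nat.ceil_lt_add_one (by positivity : 0 ≤ 6 * L)
    rw [hkdef]
    push_cast
    linarith
  have hmain : exp (∑ l ∈ (a * m).primeFactors, 1 / (l : ℝ)) ^ 3 / log w ^ 2 ≤
      4 * 560 ^ 2 * C₁ ^ 3 * (L ^ 7 / X ^ 2) := by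
    calc _ ≤ (C₁ * L) ^ 3 / (T / 2) ^ 2 := by
          gcongr
          exact h₁ X _ (by linarith) (mul_ne_zero ha hm) hlog
      _ = _ := by
          rw [hT]
          field_simp
          ring
  have hL7 : 1 ≤ L ^ 7 := one_le_pow₀ hL
  have htail : exp (-k) * log w ^ 9 ≤ L ^ 7 / X ^ 2 := by
    have h3 : exp (-k) ≤ 1 / X ^ 12 := by
      rw [← hXL, ← exp_nat_mul, one_div, ← exp_neg, exp_le_exp]
      push_cast
      linarith
    calc exp (-k) * log w ^ 9 ≤ 1 / X ^ 12 * X ^ 9 := by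
          gcongr
      _ = 1 / X ^ 3 := by field_simp
      _ ≤ 1 / X ^ 2 := by
          gcongr
          · linarith
          · norm_num
      _ ≤ _ := by gcongr
  have herr : (w : ℝ) ^ k ≤ M * (L ^ 7 / X ^ 2) := by
    have e : X / (20 * L) = 28 * L * T := by
      rw [hT]
      field_simp
      norm_num
    rw [e] at hM
    calc (w : ℝ) ^ k ≤ exp T ^ k := by gcongr
      _ = exp (k * T) := (exp_nat_mul _ _).symm
      _ ≤ exp (28 * L * T - 2 * L) := by
          rw [exp_le_exp]
          nlinarith
      _ = exp (28 * L * T) / X ^ 2 := by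
          rw [exp_sub, ← hXL, ← exp_nat_mul]
          push_cast
          rfl
      _ ≤ M * L ^ 7 / X ^ 2 := by
          gcongr
          exact hM.trans (le_mul_of_one_le_right (Nat.cast_nonneg _) hL7)
      _ = _ := mul_div_assoc _ _ _
  calc (S.ncard : ℝ) ≤ (primePairs a m w M).ncard := by
        exact_mod_cast Set.ncard_le_ncard hsub hfin
    _ ≤ _ := hk
    _ ≤ C₂ * (M * (4 * 560 ^ 2 * C₁ ^ 3 * (L ^ 7 / X ^ 2) + L ^ 7 / X ^ 2) +
        M * (L ^ 7 / X ^ 2)) := by gcongr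
    _ = _ := by ring

lemma ncard_le_sum_ncard {ι : Type*} {S : Set ℕ} {I : Finset ι} {T : ι → Set ℕ} (f : ι → ℕ → ℕ)
    (hT : ∀ i, (T i).Finite) (h : ∀ n ∈ S, ∃ i ∈ I, ∃ q ∈ T i, f i q = n) :
    (S.ncard : ℝ) ≤ ∑ i ∈ I, ((T i).ncard : ℝ) := by
  have hsub : S ⊆ (I.biUnion fun i ↦ (hT i).toFinset.image (f i) : Finset ℕ) := fun n hn ↦ by
    obtain ⟨i, hi, q, hq, rfl⟩ := h n hn
    exact Finset.mem_coe.2 (Finset.mem_biUnion.2 ⟨i, hi, Finset.mem_image_of_mem _ (by simpa)⟩)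
  have h1 := Set.ncard_le_ncard hsub (Finset.finite_toSet _)
  rw [Set.ncard_coe_finset] at h1
  have h2 : S.ncard ≤ ∑ i ∈ I, (T i).ncard := by
    refine h1.trans (Finset.card_biUnion_le.trans (Finset.sum_le_sum fun i _ ↦ ?_))
    rw [Set.ncard_eq_toFinset_card _ (hT i)]
    exact Finset.card_image_le
  exact_mod_cast h2

lemma sum_omegaWeight_floor_le {t : ℝ} (ht : 0 < t) (ht2 : t < 2) : ∃ C : ℝ, 0 < C ∧
    ∀ N : ℝ, 2 ≤ N → ∑ m ∈ Finset.Ioc 0 ⌊N⌋₊, t ^ ArithmeticFunction.cardFactors m / (m : ℝ) ≤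
      C * log N ^ t := by
  obtain ⟨C, hC, h⟩ := sum_omegaWeight_le ht ht2
  refine ⟨C, hC, fun N hN ↦ ?_⟩
  have hf : 2 ≤ ⌊N⌋₊ := Nat.le_floor (by exact_mod_cast hN)
  have hf2 : (2 : ℝ) ≤ ⌊N⌋₊ := by exact_mod_cast hf
  refine (h _ hf).trans ?_
  gcongr
  exact Nat.floor_le (by linarith)

/-- Integers with exceptionally many prime factors are rare. -/
lemma ncard_cardFactors_ge_le {y : ℝ} (hy : 1 < y) (hy2 : y < 2) (r : ℝ) :
    ∃ C : ℝ, 0 < C ∧ ∀ N : ℝ, 2 ≤ N →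
      (({n : ℕ | 1 ≤ n ∧ (n : ℝ) ≤ N ∧
        r * log (log N) ≤ ArithmeticFunction.cardFactors n}).ncard : ℝ) ≤
        C * N * log N ^ (y - r * log y) := by
  obtain ⟨C, hC, h⟩ := sum_omegaWeight_floor_le (by linarith : 0 < y) hy2
  refine ⟨C, hC, fun N hN ↦ ?_⟩
  have hy0 : 0 < y := by linarith
  have hN0 : 0 < N := by linarith
  have hX0 : 0 < log N := log_pos (by linarith)
  set L := log (log N) with hL
  set S := {n : ℕ | 1 ≤ n ∧ (n : ℝ) ≤ N ∧ r * L ≤ ArithmeticFunction.cardFactors n} with hS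
  have e : y ^ (-(r * L)) = log N ^ (-(r * log y)) := by
    rw [rpow_def_of_pos hy0, rpow_def_of_pos hX0]
    congr 1
    ring
  have hsub : S ⊆ ((Finset.Ioc 0 ⌊N⌋₊).filter
      fun n ↦ r * L ≤ ArithmeticFunction.cardFactors n : Finset ℕ) := fun n hn ↦ by
    rw [Finset.mem_coe, Finset.mem_filter, Finset.mem_Ioc]
    exact ⟨⟨hn.1, Nat.le_floor hn.2.1⟩, hn.2.2⟩
  calc (S.ncard : ℝ) ≤ ((Finset.Ioc 0 ⌊N⌋₊).filter
        fun n ↦ r * L ≤ ArithmeticFunction.cardFactors n).card := by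
        rw [← Set.ncard_coe_finset]
        exact_mod_cast Set.ncard_le_ncard hsub (Finset.finite_toSet _)
    _ ≤ ∑ n ∈ Finset.Ioc 0 ⌊N⌋₊,
        N * y ^ (-(r * L)) * (y ^ ArithmeticFunction.cardFactors n / (n : ℝ)) := by
        rw [Finset.card_filter]
        push_cast
        refine Finset.sum_le_sum fun n hn ↦ ?_
        rw [Finset.mem_Ioc, Nat.le_floor_iff hN0.le] at hn
        split_ifs with h1
        · have hn0 : (0 : ℝ) < n := by exact_mod_cast hn.1
          have h2 : 1 ≤ y ^ (-(r * L)) * y ^ ArithmeticFunction.cardFactors n := by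
            rw [← rpow_natCast, ← rpow_add hy0]
            exact one_le_rpow hy.le (by linarith)
          have h3 : 1 ≤ N / n := (one_le_div hn0).2 hn.2
          calc (1 : ℝ) ≤ (N / n) * (y ^ (-(r * L)) * y ^ ArithmeticFunction.cardFactors n) :=
                one_le_mul_of_one_le_of_one_le h3 h2
            _ = _ := by ring
        · positivity
    _ ≤ N * y ^ (-(r * L)) * (C * log N ^ y) := by
        rw [← Finset.mul_sum]
        gcongr
        exact h N hN
    _ = C * N * log N ^ (y - r * log y) := by
        rw [e, sub_eq_add_neg, rpow_add hX0]
        ring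

lemma ncard_primes_gt_le {v : ℝ} (hv : 1 < v) (M : ℕ) :
    (({q : ℕ | q ≤ M ∧ v < q ∧ q.Prime}).ncard : ℝ) ≤ log 4 * M / log v := by
  have hlog := log_pos hv
  set P := (Finset.Ioc 0 M).filter fun q : ℕ ↦ v < q ∧ q.Prime with hP
  have hsub : {q : ℕ | q ≤ M ∧ v < q ∧ q.Prime} = P := by
    ext q
    simp only [hP, Set.mem_ofPred_eq, Finset.coe_filter, Finset.mem_Ioc]
    exact ⟨fun h ↦ ⟨⟨h.2.2.pos, h.1⟩, h.2⟩, fun h ↦ ⟨h.1.2, h.2⟩⟩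
  rw [hsub, Set.ncard_coe_finset, le_div_iff₀ hlog]
  refine le_trans ?_ (Chebyshev.theta_le_log4_mul_x (Nat.cast_nonneg M))
  rw [Chebyshev.theta, Nat.floor_natCast, ← nsmul_eq_mul, ← Finset.sum_const]
  refine (Finset.sum_le_sum fun q hq ↦ ?_).trans (Finset.sum_le_sum_of_subset_of_nonneg (s := P)
    (f := fun q : ℕ ↦ log q) (fun q hq ↦ ?_) fun q _ _ ↦ log_natCast_nonneg q)
  · rw [hP, Finset.mem_filter] at hq
    exact log_le_log (by linarith) hq.2.1.le
  · rw [hP, Finset.mem_filter] at hq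
    exact Finset.mem_filter.2 ⟨hq.1, hq.2.2⟩

/-- Integers with many prime factors, one of them large. -/
lemma ncard_cardFactors_ge_and_large_prime_le {y : ℝ} (hy : 1 < y) (hy2 : y < 2) (r : ℝ) :
    ∃ C : ℝ, 0 < C ∧ ∀ N : ℝ, 2 ≤ N → 1 ≤ log (log N) →
      (({n : ℕ | 1 ≤ n ∧ (n : ℝ) ≤ N ∧ r * log (log N) ≤ ArithmeticFunction.cardFactors n ∧
        ∃ m q : ℕ, n = m * q ∧ q.Prime ∧ exp (log N / (20 * log (log N))) < q}).ncard : ℝ) ≤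
        C * N * log (log N) * log N ^ (y - 1 - r * log y) := by
  obtain ⟨C, hC, h⟩ := sum_omegaWeight_floor_le (by linarith : 0 < y) hy2
  have hl4 : 0 < log 4 := log_pos (by norm_num)
  have hy0 : 0 < y := by linarith
  refine ⟨20 * log 4 * y * C, by positivity, fun N hN hL1 ↦ ?_⟩
  have hN0 : 0 < N := by linarith
  have hX0 : 0 < log N := log_pos (by linarith)
  set X := log N with hX
  set L := log X with hL
  have hL0 : 0 < L := by linarith
  set v := exp (X / (20 * L)) with hv
  have hv1 : 1 < v := by
    rw [hv, one_lt_exp_iff]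
    positivity
  set S := {n : ℕ | 1 ≤ n ∧ (n : ℝ) ≤ N ∧ r * L ≤ ArithmeticFunction.cardFactors n ∧
        ∃ m q : ℕ, n = m * q ∧ q.Prime ∧ v < q} with hS
  have e : y ^ (-(r * L)) = X ^ (-(r * log y)) := by
    rw [rpow_def_of_pos hy0, rpow_def_of_pos hX0]
    congr 1
    ring
  set T : ℕ → Set ℕ := fun m ↦ {q | (q ≤ ⌊N⌋₊ / m ∧ v < q ∧ q.Prime) ∧
    r * L ≤ (ArithmeticFunction.cardFactors m + 1 : ℕ)} with hT
  have hTfin : ∀ m, (T m).Finite := fun m ↦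
    (Set.finite_Iic (⌊N⌋₊ / m)).subset fun q hq ↦ hq.1.1
  have hST : ∀ n ∈ S, ∃ m ∈ Finset.Ioc 0 ⌊N⌋₊, ∃ q ∈ T m, m * q = n := by
    rintro _ ⟨hn1, hnN, hnr, m, q, rfl, hq, hqv⟩
    have hm0 : m ≠ 0 := by rintro rfl; simp at hn1
    have hmq : m * q ≤ ⌊N⌋₊ := Nat.le_floor hnN
    refine ⟨m, Finset.mem_Ioc.2 ⟨Nat.pos_of_ne_zero hm0,
      (Nat.le_mul_of_pos_right _ hq.pos).trans hmq⟩, q, ⟨⟨?_, hqv, hq⟩, ?_⟩, rfl⟩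
    · rw [Nat.le_div_iff_mul_le (Nat.pos_of_ne_zero hm0), mul_comm]
      exact hmq
    · rwa [ArithmeticFunction.cardFactors_mul hm0 hq.ne_zero,
        ArithmeticFunction.cardFactors_apply_prime hq] at hnr
  refine (ncard_le_sum_ncard (fun m q ↦ m * q) hTfin hST).trans ?_
  have hTcard : ∀ m ∈ Finset.Ioc 0 ⌊N⌋₊, ((T m).ncard : ℝ) ≤
      20 * log 4 * y * (N * (L / X) * y ^ (-(r * L))) *
        (y ^ ArithmeticFunction.cardFactors m / (m : ℝ)) := by
    intro m hm
    rw [Finset.mem_Ioc] at hm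
    have hm0 : (0 : ℝ) < m := by exact_mod_cast hm.1
    by_cases hmr : r * L ≤ (ArithmeticFunction.cardFactors m + 1 : ℕ)
    · have h1 : ((T m).ncard : ℝ) ≤ log 4 * (⌊N⌋₊ / m : ℕ) / log v := by
        refine le_trans (Nat.cast_le.2 (Set.ncard_le_ncard (fun q (hq : q ∈ T m) ↦ hq.1) ?_))
          (ncard_primes_gt_le hv1 _)
        exact (Set.finite_Iic (⌊N⌋₊ / m)).subset fun q hq ↦ hq.1
      have h2 : ((⌊N⌋₊ / m : ℕ) : ℝ) ≤ N / m := by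
        refine Nat.cast_div_le.trans ?_
        gcongr
        exact Nat.floor_le hN0.le
      have h3 : 1 ≤ y ^ (-(r * L)) * y ^ (ArithmeticFunction.cardFactors m + 1) := by
        rw [← rpow_natCast, ← rpow_add hy0]
        exact one_le_rpow hy.le (by linarith)
      have hlv : log v = X / (20 * L) := log_exp _
      rw [hlv] at h1
      calc ((T m).ncard : ℝ) ≤ log 4 * (N / m) / (X / (20 * L)) := h1.trans (by gcongr)
        _ ≤ log 4 * (N / m) / (X / (20 * L)) *
            (y ^ (-(r * L)) * y ^ (ArithmeticFunction.cardFactors m + 1)) :=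
          le_mul_of_one_le_right (by positivity) h3
        _ = _ := by
          rw [pow_succ]
          field_simp
    · have : T m = ∅ := Set.eq_empty_iff_forall_notMem.2 fun q hq ↦ hmr hq.2
      rw [this, Set.ncard_empty]
      push_cast
      positivity
  refine (Finset.sum_le_sum hTcard).trans ?_
  rw [← Finset.mul_sum]
  calc _ ≤ 20 * log 4 * y * (N * (L / X) * y ^ (-(r * L))) * (C * X ^ y) := by
        gcongr
        exact h N hN
    _ = _ := by
        rw [e, sub_eq_add_neg, rpow_add hX0, rpow_sub_one hX0.ne']
        field_simp

/-- Products `ab` with few prime factors, where `b` has a large prime factor and `a² + b²` is twice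
a prime. -/
lemma ncard_cardFactors_le_and_large_prime_le {z : ℝ} (hz : 0 < z) (hz1 : z < 1) (r : ℝ) :
    ∃ C : ℝ, 0 < C ∧ ∀ N : ℝ, 2 ≤ N → 1 ≤ log (log N) → 560 * log (log N) ^ 2 ≤ log N →
      (({n : ℕ | 1 ≤ n ∧ (n : ℝ) ≤ N ∧ (ArithmeticFunction.cardFactors n : ℝ) ≤ r * log (log N) ∧
        ∃ a m q : ℕ, n = a * m * q ∧ q.Prime ∧ exp (log N / (20 * log (log N))) < q ∧
          ∃ p : ℕ, p.Prime ∧ a ^ 2 + (m * q) ^ 2 = 2 * p}).ncard : ℝ) ≤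
        C * N * log (log N) ^ 7 * log N ^ (2 * z - 2 - r * log z) := by
  obtain ⟨C, hC, h⟩ := sum_omegaWeight_floor_le hz (by linarith)
  obtain ⟨C₁, hC₁, h₁⟩ := ncard_large_prime_le
  refine ⟨C₁ * z * C ^ 2, by positivity, fun N hN hL1 hXL ↦ ?_⟩
  have hN0 : 0 < N := by linarith
  have hX0 : 0 < log N := log_pos (by linarith)
  set X := log N with hX
  set L := log X with hL
  have hL0 : 0 < L := by linarith
  set v := exp (X / (20 * L)) with hv
  set S := {n : ℕ | 1 ≤ n ∧ (n : ℝ) ≤ N ∧ (ArithmeticFunction.cardFactors n : ℝ) ≤ r * L ∧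
        ∃ a m q : ℕ, n = a * m * q ∧ q.Prime ∧ v < q ∧
          ∃ p : ℕ, p.Prime ∧ a ^ 2 + (m * q) ^ 2 = 2 * p} with hS
  have e : z ^ (-(r * L)) = X ^ (-(r * log z)) := by
    rw [rpow_def_of_pos hz, rpow_def_of_pos hX0]
    congr 1
    ring
  set I := Finset.Ioc 0 ⌊N⌋₊ with hI
  set T : ℕ × ℕ → Set ℕ := fun i ↦ {q | (q ≤ ⌊N⌋₊ / (i.1 * i.2) ∧ v < q ∧ q.Prime ∧
    ∃ p : ℕ, p.Prime ∧ i.1 ^ 2 + (i.2 * q) ^ 2 = 2 * p) ∧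
    (ArithmeticFunction.cardFactors i.1 + ArithmeticFunction.cardFactors i.2 + 1 : ℕ) ≤ r * L}
    with hT
  have hTfin : ∀ i, (T i).Finite := fun i ↦
    (Set.finite_Iic (⌊N⌋₊ / (i.1 * i.2))).subset fun q hq ↦ hq.1.1
  have hST : ∀ n ∈ S, ∃ i ∈ I ×ˢ I, ∃ q ∈ T i, i.1 * i.2 * q = n := by
    rintro _ ⟨hn1, hnN, hnr, a, m, q, rfl, hq, hqv, hp⟩
    have ha0 : a ≠ 0 := by rintro rfl; simp at hn1
    have hm0 : m ≠ 0 := by rintro rfl; simp at hn1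
    have hapos := Nat.pos_of_ne_zero ha0
    have hmpos := Nat.pos_of_ne_zero hm0
    have hamq : a * m * q ≤ ⌊N⌋₊ := Nat.le_floor hnN
    have ham : a * m ≤ ⌊N⌋₊ := (Nat.le_mul_of_pos_right _ hq.pos).trans hamq
    refine ⟨(a, m), Finset.mem_product.2 ⟨Finset.mem_Ioc.2 ⟨hapos, ?_⟩,
      Finset.mem_Ioc.2 ⟨hmpos, ?_⟩⟩, q, ⟨⟨?_, hqv, hq, hp⟩, ?_⟩, rfl⟩
    · exact (Nat.le_mul_of_pos_right _ hmpos).trans ham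
    · exact (Nat.le_mul_of_pos_left _ hapos).trans ham
    · rw [Nat.le_div_iff_mul_le (Nat.mul_pos hapos hmpos), mul_comm]
      exact hamq
    · rwa [ArithmeticFunction.cardFactors_mul (mul_ne_zero ha0 hm0) hq.ne_zero,
        ArithmeticFunction.cardFactors_mul ha0 hm0,
        ArithmeticFunction.cardFactors_apply_prime hq] at hnr
  refine (ncard_le_sum_ncard (fun i q ↦ i.1 * i.2 * q) hTfin hST).trans ?_
  have hTcard : ∀ i ∈ I ×ˢ I, ((T i).ncard : ℝ) ≤
      C₁ * z * (N * (L ^ 7 / X ^ 2) * z ^ (-(r * L))) *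
        ((z ^ ArithmeticFunction.cardFactors i.1 / (i.1 : ℝ)) *
          (z ^ ArithmeticFunction.cardFactors i.2 / (i.2 : ℝ))) := by
    rintro ⟨a, m⟩ hi
    obtain ⟨⟨ha, haN⟩, hm, hmN⟩ : (0 < a ∧ (a : ℝ) ≤ N) ∧ 0 < m ∧ (m : ℝ) ≤ N := by
      simpa [hI, Nat.le_floor_iff hN0.le] using hi
    have ha0 : (0 : ℝ) < a := by exact_mod_cast ha
    have hm0 : (0 : ℝ) < m := by exact_mod_cast hm
    dsimp only
    by_cases hr : (ArithmeticFunction.cardFactors a + ArithmeticFunction.cardFactors m + 1 : ℕ) ≤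
        r * L
    · have hlog : log (a * m : ℕ) ≤ 2 * X := by
        push_cast
        rw [log_mul ha0.ne' hm0.ne']
        linarith [log_le_log ha0 haN, log_le_log hm0 hmN]
      have h2 : ((⌊N⌋₊ / (a * m) : ℕ) : ℝ) ≤ N / (a * m) := by
        refine Nat.cast_div_le.trans ?_
        push_cast
        gcongr
        exact Nat.floor_le hN0.le
      have h3 : 1 ≤ z ^ (-(r * L)) *
          z ^ (ArithmeticFunction.cardFactors a + ArithmeticFunction.cardFactors m + 1) := by
        rw [← rpow_natCast, ← rpow_add hz]
        exact one_le_rpow_of_pos_of_le_one_of_nonpos hz hz1.le (by linarith)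
      calc ((T (a, m)).ncard : ℝ) ≤ C₁ * (((⌊N⌋₊ / (a * m) : ℕ) : ℝ) * L ^ 7 / X ^ 2) := by
            refine le_trans (Nat.cast_le.2 (Set.ncard_le_ncard
              (fun q (hq : q ∈ T (a, m)) ↦ hq.1) ?_))
              (h₁ X a m (⌊N⌋₊ / (a * m)) ha.ne' hm.ne' hL1 hXL hlog)
            exact (Set.finite_Iic (⌊N⌋₊ / (a * m))).subset fun q hq ↦ hq.1
        _ ≤ C₁ * (N / (a * m) * L ^ 7 / X ^ 2) := by gcongr
        _ ≤ C₁ * (N / (a * m) * L ^ 7 / X ^ 2) * (z ^ (-(r * L)) *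
            z ^ (ArithmeticFunction.cardFactors a + ArithmeticFunction.cardFactors m + 1)) :=
          le_mul_of_one_le_right (by positivity) h3
        _ = _ := by
          rw [pow_succ, pow_add]
          ring
    · have : T (a, m) = ∅ := Set.eq_empty_iff_forall_notMem.2 fun q hq ↦ hr hq.2
      rw [this, Set.ncard_empty]
      push_cast
      positivity
  refine (Finset.sum_le_sum hTcard).trans ?_
  rw [← Finset.mul_sum, Finset.sum_product]
  dsimp only
  rw [← Finset.sum_mul_sum]
  have hs0 : 0 ≤ ∑ m ∈ I, z ^ ArithmeticFunction.cardFactors m / (m : ℝ) :=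
    Finset.sum_nonneg fun _ _ ↦ by positivity
  calc _ ≤ C₁ * z * (N * (L ^ 7 / X ^ 2) * z ^ (-(r * L))) * ((C * X ^ z) * (C * X ^ z)) := by
        gcongr
        · exact h N hN
        · exact h N hN
    _ = _ := by
        have e2 : X ^ (2 * z - 2 - r * log z) =
            X ^ z * X ^ z * X ^ (-(r * log z)) / X ^ 2 := by
          rw [← rpow_natCast, ← rpow_add hX0, ← rpow_add hX0, ← rpow_sub hX0]
          congr 1
          push_cast
          ring
        rw [e, e2]
        field_simp

lemma exists_large_prime_factor {b : ℕ} (hb : b ≠ 0) {v : ℝ} (hv : 1 ≤ v)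
    (h : ArithmeticFunction.cardFactors b * log v < log b) :
    ∃ m q : ℕ, b = m * q ∧ q.Prime ∧ v < q := by
  by_contra! hcon
  have h1 : ∀ q ∈ b.primeFactorsList, (q : ℝ) ≤ v := fun q hq ↦ by
    obtain ⟨m, hm⟩ := Nat.dvd_of_mem_primeFactorsList hq
    exact hcon m q (by rw [hm, mul_comm]) (Nat.prime_of_mem_primeFactorsList hq)
  have h2 : ∀ l : List ℕ, (∀ q ∈ l, (q : ℝ) ≤ v) → ((l.prod : ℕ) : ℝ) ≤ v ^ l.length := by
    intro l
    induction l with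
    | nil => simp
    | cons q l ih =>
      intro hl
      rw [List.prod_cons, List.length_cons, pow_succ', Nat.cast_mul]
      exact mul_le_mul (hl q List.mem_cons_self) (ih fun p hp ↦ hl p (List.mem_cons_of_mem _ hp))
        (Nat.cast_nonneg _) (by positivity)
  have h3 := h2 _ h1
  rw [Nat.prod_primeFactorsList hb] at h3
  have h4 := log_le_log (by positivity) h3
  rw [log_pow, ← ArithmeticFunction.cardFactors_apply] at h4
  linarith

lemma finite_setOf_natCast_le (N : ℝ) : {n : ℕ | 1 ≤ n ∧ (n : ℝ) ≤ N}.Finite :=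
  (Set.finite_Iic ⌊N⌋₊).subset fun _ hn ↦ Nat.le_floor hn.2

lemma ncard_setOf_natCast_le {N : ℝ} (hN : 0 ≤ N) :
    (({n : ℕ | 1 ≤ n ∧ (n : ℝ) ≤ N}).ncard : ℝ) ≤ N := by
  have h : {n : ℕ | 1 ≤ n ∧ (n : ℝ) ≤ N} ⊆ Finset.Ioc 0 ⌊N⌋₊ := fun n hn ↦
    Finset.mem_coe.2 (Finset.mem_Ioc.2 ⟨hn.1, Nat.le_floor hn.2⟩)
  have h1 := Set.ncard_le_ncard h (Finset.finite_toSet _)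
  rw [Set.ncard_coe_finset, Nat.card_Ioc, Nat.sub_zero] at h1
  exact (Nat.cast_le.2 h1).trans (Nat.floor_le hN)

/-- An integer counted by `countA N` is small, or has many prime factors, or is a product `a * b`
where `b` has a large prime factor. -/
lemma countA_le_add (r : ℝ) {N : ℝ} (hL : 1 ≤ log (log N)) :
    (countA N : ℝ) ≤ (({n : ℕ | 1 ≤ n ∧ (n : ℝ) ≤ exp (log N / 2)}).ncard : ℝ) +
      ({n : ℕ | 1 ≤ n ∧ (n : ℝ) ≤ N ∧
        5 * log (log N) ≤ ArithmeticFunction.cardFactors n}).ncard +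
      ({n : ℕ | 1 ≤ n ∧ (n : ℝ) ≤ N ∧ r * log (log N) ≤ ArithmeticFunction.cardFactors n ∧
        ∃ m q : ℕ, n = m * q ∧ q.Prime ∧ exp (log N / (20 * log (log N))) < q}).ncard +
      ({n : ℕ | 1 ≤ n ∧ (n : ℝ) ≤ N ∧ (ArithmeticFunction.cardFactors n : ℝ) ≤ r * log (log N) ∧
        ∃ a m q : ℕ, n = a * m * q ∧ q.Prime ∧ exp (log N / (20 * log (log N))) < q ∧
          ∃ p : ℕ, p.Prime ∧ a ^ 2 + (m * q) ^ 2 = 2 * p}).ncard := by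
  set X := log N with hX
  set L := log X with hLdef
  set v := exp (X / (20 * L)) with hv
  set S₀ := {n : ℕ | 1 ≤ n ∧ (n : ℝ) ≤ exp (X / 2)} with hS₀
  set S₁ := {n : ℕ | 1 ≤ n ∧ (n : ℝ) ≤ N ∧ 5 * L ≤ ArithmeticFunction.cardFactors n} with hS₁
  set S₂ := {n : ℕ | 1 ≤ n ∧ (n : ℝ) ≤ N ∧ r * L ≤ ArithmeticFunction.cardFactors n ∧
    ∃ m q : ℕ, n = m * q ∧ q.Prime ∧ v < q} with hS₂
  set S₃ := {n : ℕ | 1 ≤ n ∧ (n : ℝ) ≤ N ∧ (ArithmeticFunction.cardFactors n : ℝ) ≤ r * L ∧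
    ∃ a m q : ℕ, n = a * m * q ∧ q.Prime ∧ v < q ∧
      ∃ p : ℕ, p.Prime ∧ a ^ 2 + (m * q) ^ 2 = 2 * p} with hS₃
  have hsub : {n : ℕ | 1 ≤ n ∧ (n : ℝ) ≤ N ∧ ∃ a b : ℕ, 0 < a ∧ 0 < b ∧ n = a * b ∧
      ∃ p : ℕ, p.Prime ∧ a ^ 2 + b ^ 2 = 2 * p} ⊆ S₀ ∪ S₁ ∪ S₂ ∪ S₃ := by
    rintro n ⟨hn1, hnN, a, b, ha, hb, hn, p, hp, hab⟩
    wlog hle : a ≤ b generalizing a b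
    · exact this b a hb ha (by rw [hn, mul_comm]) (by rw [← hab, add_comm]) (by omega)
    by_cases h0 : (n : ℝ) ≤ exp (X / 2)
    · exact Or.inl (Or.inl (Or.inl ⟨hn1, h0⟩))
    by_cases h1 : 5 * L ≤ ArithmeticFunction.cardFactors n
    · exact Or.inl (Or.inl (Or.inr ⟨hn1, hnN, h1⟩))
    rw [not_le] at h0 h1
    have hX0 : 0 ≤ X := by
      by_contra! h
      have hn1r : (1 : ℝ) ≤ n := by exact_mod_cast hn1
      have := log_nonneg (hn1r.trans hnN)
      linarith
    have hv1 : 1 ≤ v := one_le_exp (by positivity)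
    have hlogb : X / 4 < log b := by
      have hnb : (n : ℝ) ≤ (b : ℝ) ^ 2 := by
        exact_mod_cast (by rw [hn]; nlinarith : n ≤ b ^ 2)
      have := log_lt_log (exp_pos _) (h0.trans_le hnb)
      rw [log_exp, log_pow] at this
      push_cast at this
      linarith
    have hcf : ArithmeticFunction.cardFactors n =
        ArithmeticFunction.cardFactors a + ArithmeticFunction.cardFactors b := by
      rw [hn, ArithmeticFunction.cardFactors_mul ha.ne' hb.ne']
    have hcfb : (ArithmeticFunction.cardFactors b : ℝ) ≤ 5 * L := by
      rw [hcf] at h1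
      push_cast at h1
      linarith [Nat.cast_nonneg (α := ℝ) (ArithmeticFunction.cardFactors a)]
    obtain ⟨m, q, rfl, hq, hqv⟩ := exists_large_prime_factor hb.ne' hv1 (by
      refine lt_of_le_of_lt ?_ hlogb
      rw [hv, log_exp]
      calc (ArithmeticFunction.cardFactors b : ℝ) * (X / (20 * L)) ≤ 5 * L * (X / (20 * L)) := by
            gcongr
        _ = X / 4 := by field_simp; ring)
    rw [← mul_assoc] at hn
    rcases le_total (r * L) (ArithmeticFunction.cardFactors n) with h2 | h2
    · exact Or.inl (Or.inr ⟨hn1, hnN, h2, a * m, q, hn, hq, hqv⟩)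
    · exact Or.inr ⟨hn1, hnN, h2, a, m, q, hn, hq, hqv, p, hp, hab⟩
  have hfin : (S₀ ∪ S₁ ∪ S₂ ∪ S₃).Finite :=
    (((finite_setOf_natCast_le _).union ((finite_setOf_natCast_le N).subset
      fun n hn ↦ ⟨hn.1, hn.2.1⟩)).union ((finite_setOf_natCast_le N).subset
      fun n hn ↦ ⟨hn.1, hn.2.1⟩)).union ((finite_setOf_natCast_le N).subset
      fun n hn ↦ ⟨hn.1, hn.2.1⟩)
  have h := Set.ncard_le_ncard hsub hfin
  have h1 := Set.ncard_union_le (S₀ ∪ S₁ ∪ S₂) S₃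
  have h2 := Set.ncard_union_le (S₀ ∪ S₁) S₂
  have h3 := Set.ncard_union_le S₀ S₁
  exact_mod_cast (by unfold countA; omega :
    countA N ≤ S₀.ncard + S₁.ncard + S₂.ncard + S₃.ncard)

/-- The bound for `N` large enough. -/
lemma countA_le_of_large : ∃ C : ℝ, 0 < C ∧ ∀ N : ℝ, 16 ≤ N → 1 ≤ log (log N) →
    560 * log (log N) ^ 2 ≤ log N → (countA N : ℝ) ≤
      C * N * log (log N) ^ 7 * log N ^ (-(1 - (1 + log (log 2)) / log 2)) := by
  have hl1 := log_two_gt_d9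
  have hl2 := log_two_lt_d9
  have hl0 : 0 < log 2 := by linarith
  set y := 1 / log 2 with hy
  have hy1 : 1.44 < y := by rw [hy, lt_div_iff₀ hl0]; linarith
  have hy2 : y < 1.443 := by rw [hy, div_lt_iff₀ hl0]; linarith
  have hlogy : log y = -log (log 2) := by rw [hy, one_div, log_inv]
  have hlogz : log (y / 2) = -log (log 2) - log 2 := by
    rw [log_div (by linarith) two_ne_zero, hlogy]
  set η := 1 - (1 + log (log 2)) / log 2 with hη
  have e1 : y - 1 - y * log y = -η := by
    rw [hlogy, hη, hy]
    ring
  have e2 : 2 * (y / 2) - 2 - y * log (y / 2) = -η := by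
    rw [hlogz, hη, hy]
    field_simp
    ring
  have hlogy_ge : 0.306 ≤ log y := by
    have := one_sub_inv_le_log_of_pos (by linarith : 0 < y)
    rw [hy, one_div, inv_inv] at this
    rw [hy, one_div]
    linarith
  have e3 : y - 5 * log y ≤ -η := by
    rw [← e1]
    nlinarith
  have hη1 : η ≤ 1 := by
    have := one_sub_inv_le_log_of_pos hl0
    have h : (log 2)⁻¹ = y := by rw [hy, one_div]
    have : 0 ≤ (1 + log (log 2)) / log 2 := div_nonneg (by linarith) hl0.le
    linarith
  obtain ⟨C₁, hC₁, h₁⟩ := ncard_cardFactors_ge_le (by linarith : 1 < y) (by linarith) 5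
  obtain ⟨C₂, hC₂, h₂⟩ :=
    ncard_cardFactors_ge_and_large_prime_le (by linarith : 1 < y) (by linarith) y
  obtain ⟨C₃, hC₃, h₃⟩ :=
    ncard_cardFactors_le_and_large_prime_le (by linarith : 0 < y / 2) (by linarith) y
  refine ⟨1 + C₁ + C₂ + C₃, by positivity, fun N hN hL hXL ↦ ?_⟩
  have h₀ := ncard_setOf_natCast_le (exp_pos (log N / 2)).le
  replace h₁ := h₁ N (by linarith)
  replace h₂ := h₂ N (by linarith) hL
  replace h₃ := h₃ N (by linarith) hL hXL
  have hsum := countA_le_add y hL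
  rw [e1] at h₂
  rw [e2] at h₃
  have hN0 : 0 < N := by linarith
  have hNX : exp (log N) = N := exp_log hN0
  set X := log N with hX
  set L := log X with hLdef
  have hX1 : 1 ≤ X := by nlinarith
  have hL7 : 1 ≤ L ^ 7 := one_le_pow₀ hL
  have hLL7 : L ≤ L ^ 7 := le_self_pow₀ hL (by norm_num)
  have hXη : 0 < X ^ (-η) := by positivity
  have b₀ : exp (X / 2) ≤ N * L ^ 7 * X ^ (-η) := by
    have h4 : X ≤ exp (X / 2) := by
      have h5 : X / 4 + 1 ≤ exp (X / 4) := add_one_le_exp _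
      have h6 : exp (X / 2) = exp (X / 4) ^ 2 := by
        rw [← exp_nat_mul]
        congr 1
        push_cast
        ring
      rw [h6]
      nlinarith [sq_nonneg (X / 4 - 1)]
    have h7 : X⁻¹ ≤ X ^ (-η) := by
      rw [← rpow_neg_one]
      exact rpow_le_rpow_of_exponent_le hX1 (by linarith)
    calc exp (X / 2) = exp (X / 2) * X * X⁻¹ := by field_simp
      _ ≤ exp (X / 2) * exp (X / 2) * X⁻¹ := by gcongr
      _ = N * X⁻¹ := by rw [← exp_add, add_halves, hNX]
      _ ≤ N * L ^ 7 * X ^ (-η) := by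
        gcongr
        exact le_mul_of_one_le_right hN0.le hL7
  have b₁ : C₁ * N * X ^ (y - 5 * log y) ≤ C₁ * (N * L ^ 7 * X ^ (-η)) := by
    calc C₁ * N * X ^ (y - 5 * log y) ≤ C₁ * N * 1 * X ^ (-η) := by
          rw [mul_one]
          gcongr
      _ ≤ C₁ * N * L ^ 7 * X ^ (-η) := by gcongr
      _ = _ := by ring
  have b₂ : C₂ * N * L * X ^ (-η) ≤ C₂ * (N * L ^ 7 * X ^ (-η)) := by
    calc C₂ * N * L * X ^ (-η) ≤ C₂ * N * L ^ 7 * X ^ (-η) := by gcongr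
      _ = _ := by ring
  linarith

theorem stmt_2 :
    ∃ C K : ℝ, 0 < C ∧ 0 ≤ K ∧ ∀ N : ℝ, 16 ≤ N →
      (countA N : ℝ) ≤ C * N * Real.log (Real.log N) ^ K /
        Real.log N ^ (1 - (1 + Real.log (Real.log 2)) / Real.log 2) := by
  obtain ⟨C, hC, h⟩ := countA_le_of_large
  set η := 1 - (1 + log (log 2)) / log 2 with hη
  obtain ⟨X₀, hX₀⟩ := Filter.eventually_atTop.1
    ((isLittleO_pow_log_id_atTop (n := 2)).bound (by norm_num : (0 : ℝ) < 1 / 560))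
  set B := max X₀ 1 with hB
  refine ⟨C + B ^ |η|, 7, by positivity, by norm_num, fun N hN ↦ ?_⟩
  have hN0 : 0 < N := by linarith
  have hX : exp 1 ≤ log N := by
    have h1 : log 16 ≤ log N := log_le_log (by norm_num) hN
    have h2 : log 16 = 4 * log 2 := by
      rw [← log_rpow two_pos]
      norm_num
    linarith [exp_one_lt_d9, log_two_gt_d9]
  have hX0 : 0 < log N := (exp_pos 1).trans_le hX
  have hX1 : 1 ≤ log N := (one_le_exp zero_le_one).trans hX
  have hL : 1 ≤ log (log N) := by
    rw [le_log_iff_exp_le hX0]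
    exact hX
  have e : (7 : ℝ) = (7 : ℕ) := by norm_num
  rw [e, rpow_natCast, div_eq_mul_inv, ← rpow_neg hX0.le]
  have hL7 : 1 ≤ log (log N) ^ 7 := one_le_pow₀ hL
  have hXη : 0 < log N ^ (-η) := by positivity
  rcases le_total X₀ (log N) with hXX | hXX
  · have hlarge : 560 * log (log N) ^ 2 ≤ log N := by
      have := hX₀ _ hXX
      rw [norm_of_nonneg (by positivity), id, norm_of_nonneg hX0.le] at this
      linarith
    refine (h N hN hL hlarge).trans ?_
    gcongr
    exact le_add_of_nonneg_right (by positivity)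
  · have h1 : (countA N : ℝ) ≤ N := by
      refine le_trans (Nat.cast_le.2 (Set.ncard_le_ncard ?_ (finite_setOf_natCast_le N)))
        (ncard_setOf_natCast_le hN0.le)
      exact fun n hn ↦ ⟨hn.1, hn.2.1⟩
    have h2 : log N ^ η ≤ B ^ |η| :=
      calc log N ^ η ≤ log N ^ |η| := rpow_le_rpow_of_exponent_le hX1 (le_abs_self η)
        _ ≤ B ^ |η| := rpow_le_rpow hX0.le (hXX.trans (le_max_left _ _)) (abs_nonneg η)
    calc (countA N : ℝ) ≤ N := h1
      _ = log N ^ η * N * 1 * log N ^ (-η) := by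
        rw [rpow_neg hX0.le]
        field_simp
      _ ≤ (C + B ^ |η|) * N * log (log N) ^ 7 * log N ^ (-η) := by
        gcongr
        linarith
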